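/- arXiv:2109.13485 — 2 statements merged into one kernel-verified Lean document; each statement's English description precedes it below -/
import Mathlib

section
/- (Bóna) The number s_n(1342) of permutations of {1,…,n} avoiding the pattern 1342 satisfies the asymptotic formula s_n(1342) ∼ (64/(243√π)) · 8^n · n^{−5/2} as n → ∞; that is, lim_{n→∞} s_n(1342) · 243√π · n^{5/2} / (64 · 8^n) = 1. -/
open Filter

/-- `π` contains the pattern `τ`: some subsequence of `π` of length `k` has its
entries in the same relative order as `τ`. -/
def PattContains {k n : ℕ} (τ : Equiv.Perm (Fin k)) (π : Equiv.Perm (Fin n)) : Prop :=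
  ∃ f : Fin k → Fin n, StrictMono f ∧ ∀ a b : Fin k, π (f a) < π (f b) ↔ τ a < τ b

/-- `avoidCount τ n` is the number of permutations of `{1, …, n}` avoiding the
pattern `τ`. -/
noncomputable def avoidCount {k : ℕ} (τ : Equiv.Perm (Fin k)) (n : ℕ) : ℕ :=
  Nat.card {π : Equiv.Perm (Fin n) // ¬ PattContains τ π}

/-- The pattern `1342`, i.e. the permutation of `{1,2,3,4}` sending
`1↦1, 2↦3, 3↦4, 4↦2` (written here 0-indexed on `Fin 4`). -/
noncomputable def patt1342 : Equiv.Perm (Fin 4) :=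
  Equiv.ofBijective ![0, 2, 3, 1] (by decide)

namespace Bona

section GeneratingTree

open Equiv

variable {n : ℕ}

/-- `Has1342 π` unfolds the containment of `1342` into inequalities between four entries. -/
def Has1342 (π : Perm (Fin n)) : Prop :=
  ∃ i j k l, i < j ∧ j < k ∧ k < l ∧ π i < π l ∧ π l < π j ∧ π j < π k

theorem pattContains_patt1342 (π : Perm (Fin n)) :
    PattContains patt1342 π ↔ Has1342 π := by
  constructor
  · rintro ⟨f, hf, h⟩
    refine ⟨f 0, f 1, f 2, f 3, hf (by decide), hf (by decide), hf (by decide), ?_, ?_, ?_⟩ <;>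
    · rw [h]
      simp [patt1342]
  · rintro ⟨i, j, k, l, h₁, h₂, h₃, h₄, h₅, h₆⟩
    refine ⟨![i, j, k, l], ?_, ?_⟩
    · rw [Fin.strictMono_iff_lt_succ]
      intro a
      fin_cases a <;> simpa
    · intro a b
      fin_cases a <;> fin_cases b <;> simp [patt1342] <;> order

/-- Put the value `v` in front of `π`, shifting up the values that are at least `v`. -/
def ins (v : Fin (n + 1)) (π : Perm (Fin n)) : Perm (Fin (n + 1)) :=
  (finSuccEquiv n).trans ((optionCongr π).trans (finSuccEquiv' v).symm)

@[simp] theorem ins_zero (v : Fin (n + 1)) (π : Perm (Fin n)) : ins v π 0 = v := by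
  simp [ins]

@[simp] theorem ins_succ (v : Fin (n + 1)) (π : Perm (Fin n)) (i : Fin n) :
    ins v π i.succ = v.succAbove (π i) := by
  simp [ins]

theorem ins_bijective :
    Function.Bijective fun p : Fin (n + 1) × Perm (Fin n) => ins p.1 p.2 := by
  rw [Fintype.bijective_iff_injective_and_card]
  constructor
  · rintro ⟨v, π⟩ ⟨w, σ⟩ h
    have h₀ : v = w := by simpa using congrArg (· 0) h
    subst h₀
    refine Prod.ext rfl (Equiv.ext fun i => ?_)
    simpa using congrArg (· i.succ) h
  · simp [Fintype.card_perm, Nat.factorial_succ]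

/-- `π` contains a pattern `231` all of whose values are at least `m`. -/
def Has231 (π : Perm (Fin n)) (m : ℕ) : Prop :=
  ∃ i j k, i < j ∧ j < k ∧ m ≤ (π k : ℕ) ∧ π k < π i ∧ π i < π j

theorem Has231.mono {π : Perm (Fin n)} {m m' : ℕ} (hm : m' ≤ m) :
    Has231 π m → Has231 π m' := by
  rintro ⟨i, j, k, h₁, h₂, h₃, h₄⟩
  exact ⟨i, j, k, h₁, h₂, hm.trans h₃, h₄⟩

theorem not_has231 (π : Perm (Fin n)) : ¬ Has231 π n := by
  rintro ⟨i, j, k, h₁, h₂, h₃, h₄⟩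
  omega

theorem val_succAbove (v : Fin (n + 1)) (i : Fin n) :
    ((v.succAbove i : Fin (n + 1)) : ℕ) = if (i : ℕ) < v then (i : ℕ) else i + 1 := by
  simp only [Fin.succAbove, Fin.lt_def, Fin.val_castSucc]
  split_ifs <;> simp

theorem le_succAbove_iff {v : Fin (n + 1)} {i : Fin n} {m : ℕ} (hm : m ≤ v) :
    m ≤ (v.succAbove i : ℕ) ↔ m ≤ (i : ℕ) := by
  rw [val_succAbove]
  split_ifs <;> omega

theorem lt_succAbove_iff {v : Fin (n + 1)} {i : Fin n} :
    v < v.succAbove i ↔ (v : ℕ) ≤ i := by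
  rw [Fin.lt_def, val_succAbove]
  split_ifs <;> omega

theorem succAbove_lt_iff {v : Fin (n + 1)} {i : Fin n} :
    v.succAbove i < v ↔ (i : ℕ) < v := by
  rw [Fin.lt_def, val_succAbove]
  split_ifs <;> omega

theorem has1342_ins (v : Fin (n + 1)) (π : Perm (Fin n)) :
    Has1342 (ins v π) ↔ Has1342 π ∨ Has231 π v := by
  simp only [Has1342, Has231, Fin.exists_fin_succ, ins_zero, ins_succ, Fin.succ_lt_succ_iff,
    false_and, Fin.succ_pos, true_and, Fin.not_lt_zero, exists_false, false_or,
    and_false, Fin.succAbove_lt_succAbove_iff, lt_succAbove_iff]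
  exact or_comm

theorem has231_ins {v : Fin (n + 1)} (π : Perm (Fin n)) {m : ℕ} (hm : m ≤ v) :
    Has231 (ins v π) m ↔
      Has231 π m ∨ ∃ j k, j < k ∧ m ≤ (π k : ℕ) ∧ (π k : ℕ) < v ∧ (v : ℕ) ≤ π j := by
  simp only [Has231, Fin.exists_fin_succ, ins_zero, ins_succ, Fin.succ_lt_succ_iff,
    false_and, Fin.succ_pos, true_and, Fin.not_lt_zero, exists_false, false_or,
    and_false, Fin.succAbove_lt_succAbove_iff, lt_succAbove_iff, succAbove_lt_iff,
    le_succAbove_iff hm]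
  exact or_comm

/-- The value `z` is a left-to-right maximum of `π`. -/
def IsLRMax (π : Perm (Fin n)) (z : ℕ) : Prop :=
  ∀ j k, j < k → (π k : ℕ) = z → (π j : ℕ) < z

theorem isLRMax_ins_self (v : Fin (n + 1)) (π : Perm (Fin n)) : IsLRMax (ins v π) v := by
  intro j k hjk hk
  have : k = 0 := (ins v π).injective (by simpa using Fin.ext hk)
  simp [this] at hjk

theorem isLRMax_ins_of_lt {v : Fin (n + 1)} (π : Perm (Fin n)) {z : ℕ} (hz : z < v) :
    ¬ IsLRMax (ins v π) z := by
  intro h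
  have hzn : z < n := by omega
  have := h 0 (π.symm ⟨z, hzn⟩).succ (Fin.succ_pos _) (by simp [val_succAbove, hz])
  simp at this
  omega

theorem isLRMax_ins_succ {v : Fin (n + 1)} (π : Perm (Fin n)) {z : ℕ} (hz : v ≤ z) :
    IsLRMax (ins v π) (z + 1) ↔ IsLRMax π z := by
  simp only [IsLRMax, Fin.forall_fin_succ, ins_zero, ins_succ, Fin.succ_lt_succ_iff, val_succAbove,
    false_imp_iff, Fin.succ_pos, Fin.not_lt_zero, true_and,
    true_imp_iff]
  constructor
  · rintro ⟨-, h⟩ j k hjk hk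
    have := h j k hjk (by split_ifs <;> omega)
    split_ifs at this <;> omega
  · intro h
    refine ⟨fun _ _ => by omega, fun j k hjk hk => ?_⟩
    have := h j k hjk (by split_ifs at hk <;> omega)
    split_ifs <;> omega

open Classical in
/-- The least `m` such that the values of `π` that are at least `m` avoid `231`. -/
noncomputable def height (π : Perm (Fin n)) : ℕ :=
  Nat.find (p := fun m => ¬ Has231 π m) ⟨n, not_has231 π⟩

theorem height_le_iff {π : Perm (Fin n)} {m : ℕ} : height π ≤ m ↔ ¬ Has231 π m := by
  classical
  rw [height, Nat.find_le_iff]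
  exact ⟨fun ⟨k, hk, h⟩ h' => h (h'.mono hk), fun h => ⟨m, le_rfl, h⟩⟩

theorem height_le (π : Perm (Fin n)) : height π ≤ n := height_le_iff.2 (not_has231 π)

open Classical in
/-- The word recording which of the values `≥ height π` are left-to-right maxima. -/
noncomputable def state (π : Perm (Fin n)) : List Bool :=
  (List.range (n - height π)).map fun i => decide (IsLRMax π (height π + i))

/-- The effect on `state` of inserting a new first entry just above `i` values of the word. -/
def stepAt (w : List Bool) (i : ℕ) : List Bool :=
  (if i = 0 ∨ w.getD (i - 1) true = true then List.replicate i false else []) ++ true :: w.drop i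

@[simp] theorem length_state (π : Perm (Fin n)) : (state π).length = n - height π := by
  simp [state]

theorem IsLRMax.has231 {π : Perm (Fin n)} {m v : ℕ} {j k : Fin n} (hmax : IsLRMax π (v - 1))
    (hjk : j < k) (hk : m ≤ π k) (hkv : (π k : ℕ) < v) (hvj : v ≤ π j) : Has231 π m := by
  have hvn : v - 1 < n := by omega
  obtain ⟨i, hi⟩ : ∃ i, (π i : ℕ) = v - 1 := ⟨π.symm ⟨v - 1, hvn⟩, by simp⟩
  have hik : (π k : ℕ) ≠ π i := fun h => by
    have := hmax j k hjk (h.trans hi)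
    omega
  rcases lt_trichotomy i j with hij | rfl | hji
  · exact ⟨i, j, k, hij, hjk, hk, by rw [Fin.lt_def]; omega, by rw [Fin.lt_def]; omega⟩
  · omega
  · have := hmax j i hji hi
    omega

theorem height_ins_of_isLRMax {π : Perm (Fin n)} {v : Fin (n + 1)} (hv : height π ≤ v)
    (h : (v : ℕ) = height π ∨ IsLRMax π (v - 1)) : height (ins v π) = height π := by
  have hnot : ¬ Has231 π (height π) := height_le_iff.1 le_rfl
  refine le_antisymm (height_le_iff.2 fun h' => ?_) ?_
  · rcases (has231_ins π hv).1 h' with h' | ⟨j, k, hjk, hk, hkv, hvj⟩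
    · exact hnot h'
    · rcases h with h | h
      · omega
      · exact hnot (h.has231 hjk hk hkv hvj)
  · by_contra! hlt
    have h' : ¬ Has231 (ins v π) (height (ins v π)) := height_le_iff.1 le_rfl
    rw [has231_ins π (by omega), not_or] at h'
    have := height_le_iff.2 h'.1
    omega

theorem height_ins_of_not_isLRMax {π : Perm (Fin n)} {v : Fin (n + 1)} (hv : height π < v)
    (h : ¬ IsLRMax π (v - 1)) : height (ins v π) = v := by
  refine le_antisymm (height_le_iff.2 fun h' => ?_) ?_
  · rcases (has231_ins π le_rfl).1 h' with h' | ⟨j, k, hjk, hk, hkv, hvj⟩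
    · exact height_le_iff.1 hv.le h'
    · omega
  · by_contra! hlt
    have h' : ¬ Has231 (ins v π) (v - 1) := height_le_iff.1 (by omega)
    rw [has231_ins π (by omega), not_or] at h'
    refine h fun j k hjk hk => ?_
    by_contra hj
    have hne : (π j : ℕ) ≠ π k := fun h => hjk.ne (π.injective (Fin.ext h))
    exact h'.2 ⟨j, k, hjk, by omega, by omega, by omega⟩

theorem state_ins (π : Perm (Fin n)) (v : Fin (n + 1)) (i : ℕ) (hv : (v : ℕ) = height π + i) :
    state (ins v π) = stepAt (state π) i := by
  classical
  have hvn : (v : ℕ) < n + 1 := v.2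
  have hget : (i = 0 ∨ (state π).getD (i - 1) true = true) ↔
      ((v : ℕ) = height π ∨ IsLRMax π (v - 1)) := by
    rcases Nat.eq_zero_or_pos i with rfl | hi
    · simp [hv]
    · have h₁ : height π + (i - 1) = v - 1 := by omega
      rw [List.getD_eq_getElem _ _ (by simp; omega)]
      simp [state, h₁, hv]
  have hself : IsLRMax (ins v π) v := isLRMax_ins_self v π
  unfold stepAt
  simp only [hget]
  split_ifs with h
  · have hh := height_ins_of_isLRMax (by omega) h
    apply List.ext_getElem
    · simp [hh]
      omega
    · intro k h₁ h₂
      rcases lt_trichotomy k i with hk | rfl | hk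
      · have := isLRMax_ins_of_lt π (v := v) (z := height π + k) (by omega)
        simp [state, hh, this, hk]
      · simp [state, hh, ← hv, hself]
      · obtain ⟨l, rfl⟩ := Nat.exists_eq_add_of_lt hk
        have := isLRMax_ins_succ π (v := v) (z := height π + (i + l)) (by omega)
        simp [state, hh, ← this, add_assoc]
  · push Not at h
    have hh := height_ins_of_not_isLRMax (by omega) h.2
    apply List.ext_getElem
    · simp [hh]
      omega
    · intro k h₁ h₂
      rcases k with _ | k
      · simp [state, hh, hself]
      · have := isLRMax_ins_succ π (v := v) (z := v + k) (by omega)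
        simp [state, hh, ← add_assoc, ← hv, this]

/-- The permutations avoiding `1342`. -/
noncomputable def avoiders (n : ℕ) : Finset (Perm (Fin n)) :=
  open Classical in Finset.univ.filter fun π => ¬ Has1342 π

theorem card_avoiders (n : ℕ) : (avoiders n).card = avoidCount patt1342 n := by
  classical
  simp [avoidCount, avoiders, pattContains_patt1342, Nat.card_eq_fintype_card,
    Fintype.card_subtype]

theorem sum_avoiders_succ {R : Type*} [AddCommMonoid R] (φ : List Bool → R) :
    ∑ π ∈ avoiders (n + 1), φ (state π) =
      ∑ π ∈ avoiders n, ∑ i ∈ Finset.range ((state π).length + 1), φ (stepAt (state π) i) := by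
  classical
  simp only [avoiders, Finset.sum_filter]
  rw [← (ins_bijective (n := n)).sum_comp, Fintype.sum_prod_type_right]
  refine Finset.sum_congr rfl fun π _ => ?_
  simp only [has1342_ins, not_or]
  by_cases h : Has1342 π
  · simp [h]
  · simp only [h, not_false_eq_true, true_and, if_true]
    have key (v : Fin (n + 1)) : (if ¬ Has231 π v then φ (state (ins v π)) else 0) =
        if height π ≤ v then φ (stepAt (state π) (v - height π)) else 0 := by
      simp only [height_le_iff]
      split_ifs with hv
      · rfl
      · rw [state_ins π v (v - height π)]
        have := height_le_iff.2 hv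
        omega
    simp only [key]
    rw [Fin.sum_univ_eq_sum_range
      (fun v => if height π ≤ v then φ (stepAt (state π) (v - height π)) else 0),
      ← Finset.sum_filter, length_state, ← Nat.sub_add_comm (height_le π)]
    have : (Finset.range (n + 1)).filter (height π ≤ ·) = Finset.Ico (height π) (n + 1) := by
      ext
      simp
      omega
    rw [this, Finset.sum_Ico_eq_sum_range]
    simp

/-- Total size of a list of blocks, a block `b` having size `b + 1`. -/
def weight (l : List ℕ) : ℕ := (l.map (· + 1)).sum

@[simp] theorem weight_nil : weight [] = 0 := rfl

@[simp] theorem weight_cons (b : ℕ) (l : List ℕ) : weight (b :: l) = b + 1 + weight l := by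
  simp [weight]

/-- The word with given blocks, the list starting with the last block of the word. -/
def toWord : List ℕ → List Bool
  | [] => []
  | b :: l => toWord l ++ (List.replicate b false ++ [true])

@[simp] theorem length_toWord (l : List ℕ) : (toWord l).length = weight l := by
  induction l with
  | nil => rfl
  | cons b l ih =>
    simp [toWord, ih]
    omega

/-- The effect of `stepAt` on blocks, over all insertion sites. -/
def steps : List ℕ → Multiset (List ℕ)
  | [] => {[0]}
  | b :: l => (steps l).map (b :: ·) + {[weight (b :: l)]} +
      (Multiset.range b).map fun c => [c, 0]

theorem stepAt_append {w s : List Bool} {i : ℕ} (hi : i ≤ w.length) :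
    stepAt (w ++ s) i = stepAt w i ++ s := by
  rcases Nat.eq_zero_or_pos i with rfl | hpos
  · simp [stepAt]
  · have h : (w ++ s).getD (i - 1) true = w.getD (i - 1) true :=
      List.getD_append _ _ _ _ (by omega)
    simp only [stepAt, h, List.drop_append_of_le_length hi, List.append_assoc, List.cons_append]

theorem sum_stepAt_toWord {R : Type*} [AddCommMonoid R] (φ : List Bool → R) (l : List ℕ) :
    ∑ i ∈ Finset.range ((toWord l).length + 1), φ (stepAt (toWord l) i) =
      ((steps l).map fun m => φ (toWord m)).sum := by
  induction l generalizing φ with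
  | nil => simp [steps, toWord, stepAt]
  | cons b l ih =>
    have hlen : (toWord (b :: l)).length + 1 = (toWord l).length + 1 + b + 1 := by
      simp
      omega
    rw [hlen, Finset.sum_range_succ, Finset.sum_range_add]
    have h₁ : ∑ i ∈ Finset.range ((toWord l).length + 1), φ (stepAt (toWord (b :: l)) i) =
        ((steps l).map fun m => φ (toWord (b :: m))).sum := by
      rw [show ((steps l).map fun m => φ (toWord (b :: m))).sum = _ from
        (ih fun w => φ (w ++ (List.replicate b false ++ [true]))).symm]
      refine Finset.sum_congr rfl fun i hi => ?_
      rw [Finset.mem_range] at hi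
      rw [toWord, stepAt_append (by omega)]
    have h₂ : ∑ i ∈ Finset.range b, φ (stepAt (toWord (b :: l)) ((toWord l).length + 1 + i)) =
        ∑ c ∈ Finset.range b, φ (toWord [c, 0]) := by
      rw [← Finset.sum_range_reflect]
      refine Finset.sum_congr rfl fun c hc => ?_
      rw [Finset.mem_range] at hc
      congr 1
      have hd : (toWord (b :: l)).getD ((toWord l).length + 1 + (b - 1 - c) - 1) true = false := by
        rw [List.getD_eq_getElem _ _ (by simp; omega)]
        simp only [toWord]
        rw [List.getElem_append_right (by omega), List.getElem_append_left (by simp; omega)]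
        simp
      rw [stepAt, if_neg (by rw [hd]; simp), toWord,
        List.drop_append, List.drop_eq_nil_of_le (by omega)]
      have e : (toWord l).length + 1 + (b - 1 - c) - (toWord l).length = b - c := by omega
      rw [e, List.drop_append_of_le_length (by simp), List.drop_replicate]
      have e' : b - (b - c) = c := by omega
      simp [toWord, e']
    have h₃ : stepAt (toWord (b :: l)) ((toWord l).length + 1 + b) = toWord [weight (b :: l)] := by
      have hd : (toWord (b :: l)).getD ((toWord l).length + 1 + b - 1) true = true := by
        rw [List.getD_eq_getElem _ _ (by simp; omega)]
        simp only [toWord]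
        rw [List.getElem_append_right (by omega), List.getElem_append_right (by simp)]
        simp
      rw [stepAt, if_pos (Or.inr hd), List.drop_eq_nil_of_le (by simp; omega)]
      simp [toWord]
      omega
    rw [h₁, h₂, h₃]
    simp only [steps, Multiset.map_add, Multiset.map_map, Multiset.sum_add, Multiset.map_singleton,
      Multiset.sum_singleton, Function.comp_def, Finset.sum, Finset.range_val]
    exact add_right_comm _ _ _

/-- The block lists of the `1342`-avoiding permutations of length `n`. -/
def lists : ℕ → Multiset (List ℕ)
  | 0 => {[]}
  | n + 1 => (lists n).bind steps

/-- The sum of a functional over `lists n`. -/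
def listSum {R : Type*} [AddCommMonoid R] (n : ℕ) (φ : List ℕ → R) : R := ((lists n).map φ).sum

theorem listSum_zero {R : Type*} [AddCommMonoid R] (φ : List ℕ → R) : listSum 0 φ = φ [] := by
  simp [listSum, lists]

theorem listSum_succ {R : Type*} [AddCommMonoid R] (n : ℕ) (φ : List ℕ → R) :
    listSum (n + 1) φ = listSum n fun l => ((steps l).map φ).sum := by
  simp [listSum, lists, Multiset.map_bind, Multiset.sum_bind]

theorem sum_avoiders {R : Type*} [AddCommMonoid R] (n : ℕ) (φ : List Bool → R) :
    ∑ π ∈ avoiders n, φ (state π) = listSum n fun l => φ (toWord l) := by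
  induction n generalizing φ with
  | zero =>
    have : avoiders 0 = Finset.univ := by
      ext π
      simp [avoiders, Has1342]
    simp [this, listSum_zero, state, toWord]
  | succ n ih =>
    rw [sum_avoiders_succ, ih fun w => ∑ i ∈ Finset.range (w.length + 1), φ (stepAt w i),
      listSum_succ]
    simp only [sum_stepAt_toWord]

theorem avoidCount_eq_listSum {R : Type*} [AddCommMonoidWithOne R] (n : ℕ) :
    (avoidCount patt1342 n : R) = listSum n fun _ => (1 : R) := by
  rw [← card_avoiders, ← sum_avoiders n fun _ => (1 : R)]
  simp

end GeneratingTree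

section Decomposition

open Finset

variable {R : Type*} [CommRing R]

theorem listSum_add (n : ℕ) (φ ψ : List ℕ → R) :
    listSum n (fun l => φ l + ψ l) = listSum n φ + listSum n ψ :=
  Multiset.sum_map_add

theorem listSum_mul_left (n : ℕ) (a : R) (φ : List ℕ → R) :
    listSum n (fun l => a * φ l) = a * listSum n φ :=
  Multiset.sum_map_mul_left

theorem listSum_sub (n : ℕ) (φ ψ : List ℕ → R) :
    listSum n (fun l => φ l - ψ l) = listSum n φ - listSum n ψ :=
  Multiset.sum_map_sub

/-- The single blocks created by steps that merge a whole list. -/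
def merged : ℕ → Multiset ℕ
  | 0 => 0
  | n + 1 => (lists n).map weight

/-- The values to which the head of a list can be lowered by a step. -/
def lowered (n : ℕ) : Multiset ℕ := (lists n).bind fun l => Multiset.range (l.headD 0)

/-- Decomposition of a history of block lists at the last step that touches the head. -/
theorem listSum_eq (n : ℕ) (φ : List ℕ → R) :
    listSum n φ = (if n = 0 then φ [] else 0) +
      ∑ p ∈ antidiagonal n, ((merged p.1).map fun b => listSum p.2 fun l => φ (b :: l)).sum +
      ∑ p ∈ antidiagonal n, ((lowered p.1).map fun b =>
        (listSum p.2 fun l => φ (b :: l)) - if p.2 = 0 then φ [b] else 0).sum := by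
  induction n generalizing φ with
  | zero => simp [listSum_zero, merged]
  | succ n ih =>
    let ρ : List ℕ → R
      | [] => 0
      | b :: l => ((steps l).map fun m => φ (b :: m)).sum
    have hsplit (l : List ℕ) : ((steps l).map φ).sum = ρ l +
        (φ [weight l] + ((Multiset.range (l.headD 0)).map fun c => φ [c, 0]).sum) := by
      cases l <;> simp [steps, ρ, add_assoc, add_left_comm]
    have hmerged : ((merged (n + 1)).map fun b => φ [b]).sum = listSum n fun l => φ [weight l] := by
      simp [merged, listSum]
    have hlowered : ((lowered n).map fun b => φ [b, 0]).sum =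
        listSum n fun l => ((Multiset.range (l.headD 0)).map fun c => φ [c, 0]).sum := by
      simp [lowered, listSum, Multiset.map_bind, Multiset.sum_bind]
    have hcorner : ∑ p ∈ antidiagonal n, ((lowered p.1).map fun b =>
        (listSum (p.2 + 1) fun l => φ (b :: l)) - if p.2 = 0 then φ [b, 0] else 0).sum =
        ∑ p ∈ antidiagonal n, ((lowered p.1).map fun b => listSum (p.2 + 1) fun l => φ (b :: l)).sum
          - ((lowered n).map fun b => φ [b, 0]).sum := by
      simp only [Multiset.sum_map_sub, Finset.sum_sub_distrib]
      congr 1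
      rw [Finset.sum_eq_single (n, 0)]
      · simp
      · rintro ⟨i, j⟩ hp hne
        have : j ≠ 0 := by
          rintro rfl
          simp_all
        simp [this]
      · simp
    rw [listSum_succ]
    simp only [hsplit]
    rw [listSum_add, listSum_add, ih ρ, Finset.Nat.sum_antidiagonal_succ',
      Finset.Nat.sum_antidiagonal_succ', ← hmerged, ← hlowered]
    simp only [ρ, ← listSum_succ, listSum_zero, steps, Multiset.map_singleton,
      Multiset.sum_singleton]
    rw [hcorner]
    simp
    ring

end Decomposition

section GeneratingFunction

open Finset PowerSeries

variable {R : Type*} [CommRing R]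

/-- The generating function of a functional on block lists. -/
noncomputable def gf (φ : List ℕ → R) : PowerSeries R := PowerSeries.mk fun n => listSum n φ

/-- The generating function of `merged`. -/
noncomputable def mergedGF (f : ℕ → R) : PowerSeries R :=
  PowerSeries.mk fun n => ((merged n).map f).sum

/-- The generating function of `lowered`. -/
noncomputable def loweredGF (f : ℕ → R) : PowerSeries R :=
  PowerSeries.mk fun n => ((lowered n).map f).sum

theorem gf_eq_of_cons {φ ψ : List ℕ → R} {f : ℕ → R} (h : ∀ b l, φ (b :: l) = f b * ψ l)
    (hψ : ψ [] = 1) :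
    gf φ = C (φ []) + mergedGF f * gf ψ + loweredGF f * (gf ψ - 1) := by
  ext n
  simp only [gf, mergedGF, loweredGF, map_add, coeff_mul, map_sub, coeff_mk, coeff_C, coeff_one]
  rw [listSum_eq n φ]
  simp only [h, listSum_mul_left, hψ, mul_one, Multiset.sum_map_mul_right]
  congr 1
  refine Finset.sum_congr rfl fun p _ => ?_
  rw [← Multiset.sum_map_mul_right]
  simp [mul_sub]

theorem listSum_isEmpty (n : ℕ) :
    (listSum n fun l => if l = [] then (1 : R) else 0) = if n = 0 then 1 else 0 := by
  cases n with
  | zero => simp [listSum_zero]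
  | succ n =>
    have (l : List ℕ) : ((steps l).map fun m => if m = [] then (1 : R) else 0).sum = 0 := by
      refine Multiset.sum_eq_zero fun x hx => ?_
      obtain ⟨m, hm, rfl⟩ := Multiset.mem_map.1 hx
      have : m ≠ [] := by
        cases l <;> simp [steps] at hm <;> aesop
      simp [this]
    rw [listSum_succ]
    simp [this, listSum]

theorem gf_equation (u : R) :
    X * C u ^ 2 * gf (fun l => u ^ weight l) ^ 2 +
      gf (fun _ => 1) * (1 - C u - X * C u) * gf (fun l => u ^ weight l) -
      gf (fun _ => 1) * (1 - C u) = 0 := by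
  let d : List ℕ → R
    | [] => 0
    | b :: _ => u ^ (b + 1)
  have hV := gf_eq_of_cons (φ := fun l => u ^ weight l) (ψ := fun l => u ^ weight l)
    (f := fun b => u ^ (b + 1)) (fun b l => by simp [pow_add]) (by simp)
  have hD := gf_eq_of_cons (φ := d) (ψ := fun _ => 1)
    (f := fun b => u ^ (b + 1)) (fun b l => by simp [d]) rfl
  have hB : mergedGF (fun b => u ^ (b + 1)) = X * (C u * gf fun l => u ^ weight l) := by
    ext n
    cases n with
    | zero => simp [mergedGF, merged]
    | succ n =>
      simp [mergedGF, merged, coeff_succ_X_mul, gf, pow_succ', ← listSum_mul_left]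
      rfl
  have hC : (1 - C u) * loweredGF (fun b => u ^ (b + 1)) = C u * (gf (fun _ => 1) - 1) - gf d := by
    ext n
    have hl (l : List ℕ) :
        (1 - u) * ((Multiset.range (l.headD 0)).map fun c => u ^ (c + 1)).sum =
          u * (1 - if l = [] then 1 else 0) - d l := by
      cases l with
      | nil => simp [d]
      | cons b l =>
        have := mul_neg_geom_sum u b
        change (1 - u) * ∑ c ∈ range b, u ^ (c + 1) = _
        simp only [pow_succ', ← Finset.mul_sum, d]
        simp
        linear_combination u * this
    have hlow : (coeff n) (loweredGF fun b => u ^ (b + 1)) =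
        listSum n fun l => ((Multiset.range (l.headD 0)).map fun c => u ^ (c + 1)).sum := by
      simp [loweredGF, lowered, listSum, Multiset.map_bind, Multiset.sum_bind]
    rw [← map_one (C (R := R)), ← map_sub, coeff_C_mul, hlow, ← listSum_mul_left]
    simp only [hl]
    rw [listSum_sub, listSum_mul_left, listSum_sub, listSum_isEmpty]
    simp [gf, coeff_C_mul, coeff_one]
  simp only [d, weight_nil, pow_zero, map_one, map_zero] at hV hD
  rw [hD] at hC
  rw [hB] at hV hC
  set V := gf fun l => u ^ weight l
  set H := gf fun _ => (1 : R)
  linear_combination (H - C u) * hV + (V - 1) * hC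

end GeneratingFunction
section Solution

open PowerSeries

/-- The functional equation relating a series `V` in `x` and a catalytic variable `u` to its
specialization `H` at `u = 1`. -/
structure IsSolution (V : PowerSeries (Polynomial ℚ)) (H : PowerSeries ℚ) : Prop where
  eqn : X * C Polynomial.X ^ 2 * V ^ 2 +
    PowerSeries.map Polynomial.C H * (1 - C Polynomial.X - X * C Polynomial.X) * V -
    PowerSeries.map Polynomial.C H * (1 - C Polynomial.X) = 0
  map_eval : PowerSeries.map (Polynomial.evalRingHom 1) V = H
  constCoeff : constantCoeff V = 1

theorem map_eval_map_C (H : PowerSeries ℚ) :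
    PowerSeries.map (Polynomial.evalRingHom 1) (PowerSeries.map Polynomial.C H) = H := by
  ext
  simp

theorem IsSolution.pow_dvd {V V' : PowerSeries (Polynomial ℚ)} {H H' : PowerSeries ℚ}
    (h : IsSolution V H) (h' : IsSolution V' H') (n : ℕ) : X ^ n ∣ V - V' := by
  induction n with
  | zero => simp
  | succ n ih =>
    obtain ⟨W, hW⟩ := ih
    obtain ⟨Z, hZ⟩ : X ∣ V' - 1 := by simp [X_dvd_iff, h'.constCoeff]
    have hH : PowerSeries.map Polynomial.C H - PowerSeries.map Polynomial.C H' =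
        X ^ n * PowerSeries.map Polynomial.C (PowerSeries.map (Polynomial.evalRingHom 1) W) := by
      have := congrArg
        (fun S => PowerSeries.map Polynomial.C (PowerSeries.map (Polynomial.evalRingHom 1) S)) hW
      simpa [h.map_eval, h'.map_eval] using this
    have hunit : IsUnit (PowerSeries.map Polynomial.C H) := by
      have : constantCoeff H = 1 := by
        simp [← h.map_eval, ← coeff_zero_eq_constantCoeff_apply,
          coeff_zero_eq_constantCoeff_apply V, h.constCoeff]
      simp [isUnit_iff_constantCoeff, this]
    have hdvd : X ^ (n + 1) ∣
        PowerSeries.map Polynomial.C H * (C (1 - Polynomial.X) * (V - V')) := by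
      set K := PowerSeries.map Polynomial.C H
      set K' := PowerSeries.map Polynomial.C H'
      set w := PowerSeries.map Polynomial.C (PowerSeries.map (Polynomial.evalRingHom 1) W)
      refine ⟨C Polynomial.X * (K * W + w * V') - C Polynomial.X ^ 2 * W * (V + V') -
        w * Z * (1 - C Polynomial.X), ?_⟩
      rw [map_sub, map_one]
      linear_combination h.eqn - h'.eqn +
        (X * C Polynomial.X * K - X * C Polynomial.X ^ 2 * (V + V')) * hW +
        (X * C Polynomial.X * V' - (1 - C Polynomial.X) * (V' - 1)) * hH -
        X ^ n * w * (1 - C Polynomial.X) * hZ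
    rw [hunit.dvd_mul_left, X_pow_dvd_iff] at hdvd
    refine X_pow_dvd_iff.2 fun m hm => ?_
    have := hdvd m hm
    rw [coeff_C_mul, mul_eq_zero] at this
    refine this.resolve_left fun h0 => ?_
    simpa using congrArg (Polynomial.eval 0) h0

theorem IsSolution.unique {V V' : PowerSeries (Polynomial ℚ)} {H H' : PowerSeries ℚ}
    (h : IsSolution V H) (h' : IsSolution V' H') : H = H' := by
  have : V = V' := by
    rw [← sub_eq_zero]
    ext1 n
    exact X_pow_dvd_iff.1 (h.pow_dvd h' (n + 1)) n n.lt_succ_self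
  rw [← h.map_eval, ← h'.map_eval, this]

/-- The series `T` with `T = x + 2 T ^ 2`. -/
noncomputable def scaledCatalan : PowerSeries ℚ :=
  X * rescale 2 (PowerSeries.map (Nat.castRingHom ℚ) catalanSeries)

theorem catalanSeries_cast :
    PowerSeries.map (Nat.castRingHom ℚ) catalanSeries =
      1 + X * PowerSeries.map (Nat.castRingHom ℚ) catalanSeries ^ 2 := by
  conv_lhs => rw [← catalanSeries_sq_mul_X_add_one]
  simp
  ring

theorem scaledCatalan_eq : scaledCatalan = X + 2 * scaledCatalan ^ 2 := by
  have h := congrArg (rescale (2 : ℚ)) catalanSeries_cast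
  simp only [map_add, map_mul, map_pow, map_one, rescale_X] at h
  have h2 : C (2 : ℚ) = 2 := map_ofNat C 2
  rw [h2] at h
  unfold scaledCatalan
  linear_combination X * h

theorem coeff_succ_scaledCatalan (n : ℕ) :
    coeff (n + 1) scaledCatalan = 2 ^ n * (catalan n : ℚ) := by
  simp [scaledCatalan, coeff_succ_X_mul, coeff_rescale]

@[simp] theorem constantCoeff_scaledCatalan : constantCoeff scaledCatalan = 0 := by
  simp [scaledCatalan]

theorem exists_catalan_subst {a : PowerSeries (Polynomial ℚ)} (ha : constantCoeff a = 0) :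
    ∃ c, c = 1 + a * c ^ 2 := by
  have hs : HasSubst a := HasSubst.of_constantCoeff_zero' ha
  refine ⟨(PowerSeries.map (Nat.castRingHom ℚ) catalanSeries).subst a, ?_⟩
  conv_lhs => rw [catalanSeries_cast]
  rw [← coe_substAlgHom hs]
  simp only [map_add, map_mul, map_pow, map_one]
  rw [coe_substAlgHom hs, subst_X hs]

theorem exists_solution :
    ∃ V H, IsSolution V H ∧ H * (1 - scaledCatalan) ^ 3 = 1 - 2 * scaledCatalan := by
  set t := scaledCatalan with ht
  set i := (1 - t)⁻¹ with hi
  have hti : (1 - t) * i = 1 := PowerSeries.mul_inv_cancel _ (by simp [ht])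
  set s := PowerSeries.map Polynomial.C t with hs
  set j := PowerSeries.map Polynomial.C i with hj
  have hsj : (1 - s) * j = 1 := by
    have := congrArg (PowerSeries.map Polynomial.C) hti
    simpa using this
  have hX : X = s - 2 * s ^ 2 := by
    have := congrArg (PowerSeries.map Polynomial.C) scaledCatalan_eq
    simp only [map_add, map_mul, map_pow, map_ofNat, map_X, ← ht, ← hs] at this
    linear_combination -this
  have hs0 : constantCoeff s = 0 := by
    rw [hs, ← coeff_zero_eq_constantCoeff_apply, coeff_map, coeff_zero_eq_constantCoeff_apply, ht,
      constantCoeff_scaledCatalan, map_zero]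
  obtain ⟨c, hc⟩ := exists_catalan_subst (a := s * (1 - s) * C Polynomial.X) (by simp [hs0])
  refine ⟨c * (1 - s * c) * j, (1 - 2 * t) * i ^ 3, ⟨?_, ?_, ?_⟩, ?_⟩
  · have hne : (1 - s) ^ 4 ≠ 0 := by
      refine pow_ne_zero _ fun h => ?_
      simp [h] at hsj
    refine (mul_eq_zero.1 ?_).resolve_left hne
    simp only [map_mul, map_sub, map_one, map_pow, map_ofNat, ← hs, ← hj]
    set u := C (Polynomial.X : Polynomial ℚ)
    linear_combination
      -(1 - 2 * s) * ((1 - s) * (1 - s * c) ^ 2 * u - (1 - s - s * c)) * hc +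
      (u ^ 2 * c ^ 2 * (1 - s * c) ^ 2 * (1 - s) ^ 2 - (1 - 2 * s) * u * c * (1 - s * c)) * hX +
      (X * u ^ 2 * c ^ 2 * (1 - s * c) ^ 2 * (1 - s) ^ 2 * ((1 - s) * j + 1) +
        (1 - 2 * s) * (1 - u - X * u) * c * (1 - s * c) *
          (((1 - s) * j) ^ 3 + ((1 - s) * j) ^ 2 + (1 - s) * j + 1) -
        (1 - 2 * s) * (1 - u) * (1 - s) * (((1 - s) * j) ^ 2 + (1 - s) * j + 1)) * hsj
  · have hd := congrArg (PowerSeries.map (Polynomial.evalRingHom 1)) hc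
    simp only [map_add, map_mul, map_sub, map_one, map_pow, hs, hj, map_eval_map_C, map_C,
      Polynomial.coe_evalRingHom, Polynomial.eval_X, mul_one] at hd ⊢
    set d := PowerSeries.map (Polynomial.evalRingHom 1) c
    have hne : t * d - 1 ≠ 0 := fun h => by
      simpa [ht] using congrArg constantCoeff h
    have h1 : (1 - t) * d - 1 = 0 := by
      refine (mul_eq_zero.1 ?_).resolve_right hne
      linear_combination -hd
    have hdi : d = i := by linear_combination i * h1 - d * hti
    rw [hdi]
    linear_combination -i ^ 2 * hti
  · have hc0 : constantCoeff c = 1 := by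
      rw [hc]
      simp [hs0]
    have hj0 := congrArg constantCoeff hsj
    simp only [map_mul, map_sub, map_one, hs0, sub_zero, one_mul] at hj0
    simp [hc0, hs0, hj0]
  · linear_combination (1 - 2 * t) * ((1 - t) ^ 2 * i ^ 2 + (1 - t) * i + 1) * hti

/-- The generating function of the numbers of `1342`-avoiding permutations. -/
noncomputable def avoidGF : PowerSeries ℚ := PowerSeries.mk fun n => (avoidCount patt1342 n : ℚ)

theorem map_gf {R S : Type*} [CommRing R] [CommRing S] (f : R →+* S) (φ : List ℕ → R) :
    PowerSeries.map f (gf φ) = gf fun l => f (φ l) := by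
  ext n
  simp [gf, listSum, map_multiset_sum]

theorem isSolution_avoidGF :
    IsSolution (gf fun l => (Polynomial.X : Polynomial ℚ) ^ weight l) avoidGF := by
  have h1 : avoidGF = gf fun _ => (1 : ℚ) := by
    ext n
    simp [avoidGF, gf, avoidCount_eq_listSum]
  refine ⟨?_, ?_, ?_⟩
  · rw [h1, map_gf]
    simpa using gf_equation (Polynomial.X : Polynomial ℚ)
  · rw [h1, map_gf]
    simp
  · simp [gf, ← coeff_zero_eq_constantCoeff_apply, listSum_zero]

theorem avoidGF_mul : avoidGF * (1 - scaledCatalan) ^ 3 = 1 - 2 * scaledCatalan := by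
  obtain ⟨V, H, h, hH⟩ := exists_solution
  rw [isSolution_avoidGF.unique h, hH]

theorem avoidGF_eq :
    2 * (1 + X) ^ 3 * avoidGF = 1 + 20 * X - 8 * X ^ 2 + (1 - 8 * X) * (1 - 4 * scaledCatalan) := by
  have hne : (1 - scaledCatalan) ^ 3 ≠ 0 := by
    refine pow_ne_zero _ fun h => ?_
    simpa using congrArg constantCoeff h
  refine mul_right_cancel₀ hne ?_
  rw [mul_assoc, avoidGF_mul]
  have hX : X = scaledCatalan - 2 * scaledCatalan ^ 2 := by
    linear_combination -scaledCatalan_eq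
  rw [hX]
  ring

end Solution
section Asymptotics

open Topology

theorem tendsto_zero_of_le_half_add {e δ : ℕ → ℝ} (he : ∀ n, 0 ≤ e n)
    (h : ∀ᶠ n in atTop, e (n + 1) ≤ e n / 2 + δ n) (hδ : Tendsto δ atTop (𝓝 0)) :
    Tendsto e atTop (𝓝 0) := by
  refine (tendsto_order.2 ⟨fun a ha => .of_forall fun n => ha.trans_le (he n), fun ε hε => ?_⟩)
  obtain ⟨N, hN⟩ := eventually_atTop.1 (h.and (hδ.eventually_lt_const (by linarith : 0 < ε / 4)))
  have key (k : ℕ) : e (N + k) ≤ ε / 2 + (1 / 2) ^ k * e N := by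
    induction k with
    | zero =>
      simp
      linarith
    | succ k ih =>
      have := hN (N + k) (by omega)
      rw [← add_assoc, pow_succ]
      linarith
  have hlim : Tendsto (fun k : ℕ => (1 / 2 : ℝ) ^ k * e N) atTop (𝓝 (0 * e N)) :=
    (tendsto_pow_atTop_nhds_zero_of_lt_one (by norm_num) (by norm_num)).mul_const _
  rw [zero_mul] at hlim
  obtain ⟨K, hK⟩ := eventually_atTop.1 (hlim.eventually_lt_const (by linarith : 0 < ε / 2))
  filter_upwards [eventually_ge_atTop (N + K)] with n hn
  obtain ⟨k, rfl⟩ := Nat.exists_eq_add_of_le (le_trans (Nat.le_add_right N K) hn)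
  linarith [key k, hK k (by omega)]

/-- The inverse of the order of growth of the coefficients. -/
noncomputable def growthInv (n : ℕ) : ℝ := (n : ℝ) ^ ((5 : ℝ) / 2) / 8 ^ n

theorem tendsto_growthInv_div :
    Tendsto (fun n => growthInv (n + 1) / growthInv n) atTop (𝓝 (1 / 8)) := by
  have h₁ : Tendsto (fun n : ℕ => (((n : ℝ) + 1) / n) ^ ((5 : ℝ) / 2) / 8) atTop
      (𝓝 ((1 : ℝ) ^ ((5 : ℝ) / 2) / 8)) := by
    refine (Tendsto.rpow_const ?_ (Or.inl one_ne_zero)).div_const _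
    have := (tendsto_const_nhds (x := (1 : ℝ))).add tendsto_one_div_atTop_nhds_zero_nat
    rw [add_zero] at this
    refine this.congr' ?_
    filter_upwards [eventually_ne_atTop 0] with n hn
    field_simp
  rw [Real.one_rpow] at h₁
  refine h₁.congr' ?_
  filter_upwards [eventually_gt_atTop 0] with n hn
  have hn' : (0 : ℝ) < n := by exact_mod_cast hn
  have : (0 : ℝ) < (n : ℝ) ^ ((5 : ℝ) / 2) := by positivity
  rw [Real.div_rpow (by positivity) (by positivity), growthInv, growthInv, pow_succ]
  push_cast
  field_simp

theorem tendsto_of_add_succ {a b : ℕ → ℝ} {L : ℝ} (hab : ∀ n, b (n + 1) = a (n + 1) + a n)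
    (hb : Tendsto (fun n => b n * growthInv n) atTop (𝓝 L)) :
    Tendsto (fun n => a n * growthInv n) atTop (𝓝 (8 / 9 * L)) := by
  have hb' : Tendsto (fun n => b (n + 1) * growthInv (n + 1) - L) atTop (𝓝 0) := by
    simpa using ((tendsto_add_atTop_iff_nat 1).2 hb).sub_const L
  have hr : Tendsto (fun n => (growthInv (n + 1) / growthInv n - 1 / 8) * (8 / 9 * L)) atTop
      (𝓝 0) := by
    simpa using (tendsto_growthInv_div.sub_const (1 / 8)).mul_const (8 / 9 * L)
  have hδ : Tendsto (fun n => |(b (n + 1) * growthInv (n + 1) - L) -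
      (growthInv (n + 1) / growthInv n - 1 / 8) * (8 / 9 * L)|) atTop (𝓝 0) := by
    simpa using (hb'.sub hr).abs
  rw [tendsto_iff_norm_sub_tendsto_zero]
  refine tendsto_zero_of_le_half_add (fun _ => norm_nonneg _) ?_ hδ
  filter_upwards [tendsto_growthInv_div.eventually_le_const (by norm_num : (1 / 8 : ℝ) < 1 / 2),
    eventually_gt_atTop 0] with n hn hpos
  have hw (m : ℕ) (hm : 0 < m) : 0 < growthInv m := by
    have : (0 : ℝ) < m := by exact_mod_cast hm
    unfold growthInv
    positivity
  have hn0 := hw n hpos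
  have hn1 := hw (n + 1) n.succ_pos
  set r := growthInv (n + 1) / growthInv n with hrdef
  have hr0 : 0 ≤ r := by positivity
  have hrw : growthInv (n + 1) = r * growthInv n := by
    rw [hrdef]
    field_simp
  have e : a (n + 1) * growthInv (n + 1) - 8 / 9 * L =
      ((b (n + 1) * growthInv (n + 1) - L) - (r - 1 / 8) * (8 / 9 * L)) -
        r * (a n * growthInv n - 8 / 9 * L) := by
    rw [hab, hrw]
    ring
  rw [e, Real.norm_eq_abs, Real.norm_eq_abs]
  have h₁ := abs_sub ((b (n + 1) * growthInv (n + 1) - L) - (r - 1 / 8) * (8 / 9 * L))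
    (r * (a n * growthInv n - 8 / 9 * L))
  have h₂ : |r * (a n * growthInv n - 8 / 9 * L)| ≤ |a n * growthInv n - 8 / 9 * L| / 2 := by
    rw [abs_mul, abs_of_nonneg hr0]
    nlinarith [abs_nonneg (a n * growthInv n - 8 / 9 * L)]
  linarith

theorem tendsto_centralBinom :
    Tendsto (fun n : ℕ => (n.centralBinom : ℝ) / 4 ^ n * √n) atTop (𝓝 (1 / √Real.pi)) := by
  have h₁ : Tendsto (fun n : ℕ => (n : ℝ) / (2 * n + 1)) atTop (𝓝 (1 / 2)) := by
    have := (tendsto_one_div_atTop_nhds_zero_nat (𝕜 := ℝ)).const_add 2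
    have := (tendsto_const_nhds (x := (1 : ℝ))).div this (by norm_num)
    rw [add_zero] at this
    refine this.congr' ?_
    filter_upwards [eventually_ne_atTop 0] with n hn
    simp only [Pi.div_apply]
    field_simp
  have h₂ := (h₁.div Real.Wallis.tendsto_W_nhds_pi_div_two (by positivity)).sqrt
  have e : √(1 / 2 / (Real.pi / 2)) = 1 / √Real.pi := by
    rw [← Real.sqrt_one, ← Real.sqrt_div zero_le_one, Real.sqrt_one]
    congr 1
    field_simp
  rw [e] at h₂
  refine h₂.congr fun n => ?_
  have hc : ((n.centralBinom : ℝ)) * (n.factorial : ℝ) ^ 2 = ((2 * n).factorial : ℝ) := by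
    have := Nat.choose_mul_factorial_mul_factorial (show n ≤ 2 * n by omega)
    rw [show 2 * n - n = n by omega] at this
    rw [Nat.centralBinom_eq_two_mul_choose, ← this]
    push_cast
    ring
  have hf : (n.factorial : ℝ) ≠ 0 := by positivity
  have hcb : (n.centralBinom : ℝ) ≠ 0 := by exact_mod_cast n.centralBinom_ne_zero
  rw [← Real.sqrt_sq (by positivity : (0 : ℝ) ≤ (n.centralBinom : ℝ) / 4 ^ n * √n), mul_pow,
    Real.sq_sqrt (by positivity)]
  congr 1
  simp only [Pi.div_apply]
  rw [Real.Wallis.W_eq_factorial_ratio, ← hc, pow_mul]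
  have h16 : ((2 : ℝ) ^ 4) ^ n = (4 ^ n) ^ 2 := by
    rw [← pow_mul 4, mul_comm n 2, pow_mul]
    norm_num
  rw [h16]
  field_simp

/-- The coefficients of `(1 + x) ^ j` times the generating function of the avoiders. -/
noncomputable def avoidCoeff (j n : ℕ) : ℝ :=
  (PowerSeries.coeff n ((1 + PowerSeries.X) ^ j * avoidGF) : ℚ)

theorem avoidCoeff_succ (j n : ℕ) :
    avoidCoeff (j + 1) (n + 1) = avoidCoeff j (n + 1) + avoidCoeff j n := by
  simp only [avoidCoeff]
  rw [pow_succ', mul_assoc, add_mul, one_mul, map_add, PowerSeries.coeff_succ_X_mul]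
  push_cast
  rfl

theorem avoidCoeff_three (n : ℕ) :
    avoidCoeff 3 (n + 3) = 48 * 2 ^ n * (n + 1).centralBinom / ((n + 2) * (n + 3)) := by
  have h := congrArg (PowerSeries.coeff (n + 3)) (show PowerSeries.C 2 *
      ((1 + PowerSeries.X) ^ 3 * avoidGF) = PowerSeries.C 2 + PowerSeries.C 12 * PowerSeries.X -
        PowerSeries.C 8 * PowerSeries.X ^ 2 - PowerSeries.C 4 * scaledCatalan +
        PowerSeries.C 32 * (PowerSeries.X * scaledCatalan) by
    simp only [map_ofNat]
    linear_combination avoidGF_eq)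
  simp only [map_add, map_sub, PowerSeries.coeff_C_mul, PowerSeries.coeff_C, PowerSeries.coeff_X,
    PowerSeries.coeff_X_pow, PowerSeries.coeff_succ_X_mul, coeff_succ_scaledCatalan] at h
  simp only [Nat.add_eq_zero_iff, OfNat.ofNat_ne_zero, and_false, if_false, Nat.reduceEqDiff,
    mul_zero] at h
  have c₁ : ((n : ℚ) + 2) * catalan (n + 1) = (n + 1).centralBinom := by
    exact_mod_cast succ_mul_catalan_eq_centralBinom (n + 1)
  have c₂ : ((n : ℚ) + 3) * catalan (n + 2) = (n + 2).centralBinom := by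
    exact_mod_cast succ_mul_catalan_eq_centralBinom (n + 2)
  have c₃ : ((n : ℚ) + 2) * (n + 2).centralBinom =
      2 * (2 * (n + 1) + 1) * (n + 1).centralBinom := by
    exact_mod_cast Nat.succ_mul_centralBinom_succ (n + 1)
  have h' : (PowerSeries.coeff (n + 3) ((1 + PowerSeries.X) ^ 3 * avoidGF) : ℚ) =
      48 * 2 ^ n * (n + 1).centralBinom / ((n + 2) * (n + 3)) := by
    rw [eq_div_iff (by positivity)]
    linear_combination ((n : ℚ) + 2) * (n + 3) / 2 * h - 8 * 2 ^ n * (n + 2) * c₂ -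
      8 * 2 ^ n * c₃ + 32 * 2 ^ n * (n + 3) * c₁
  rw [avoidCoeff, h']
  push_cast
  rfl

theorem tendsto_avoidCoeff_three :
    Tendsto (fun n => avoidCoeff 3 n * growthInv n) atTop (𝓝 (3 / (8 * √Real.pi))) := by
  rw [← tendsto_add_atTop_iff_nat 3]
  have hinv (k : ℕ) : Tendsto (fun n : ℕ => 1 / (((n + k : ℕ) : ℝ) + 1)) atTop (𝓝 0) :=
    (tendsto_add_atTop_iff_nat k).2 tendsto_one_div_add_atTop_nhds_zero_nat
  have h₁ : Tendsto (fun n : ℕ => ((n : ℝ) + 3) / (n + 2)) atTop (𝓝 1) := by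
    have := (hinv 1).const_add 1
    rw [add_zero] at this
    refine this.congr fun n => ?_
    push_cast
    field_simp
    ring
  have h₂ : Tendsto (fun n : ℕ => √(((n : ℝ) + 3) / (n + 1))) atTop (𝓝 1) := by
    have := (((hinv 0).const_mul 2).const_add 1).sqrt
    rw [mul_zero, add_zero, Real.sqrt_one] at this
    refine this.congr fun n => ?_
    congr 1
    push_cast
    field_simp
    ring
  have h₃ := ((tendsto_add_atTop_iff_nat 1).2 tendsto_centralBinom).const_mul (3 / 8)
  have h := (h₃.mul h₁).mul h₂
  have e : 3 / 8 * (1 / √Real.pi) * 1 * 1 = 3 / (8 * √Real.pi) := by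
    field_simp
  rw [e] at h
  refine h.congr fun n => ?_
  have hp : ((n + 3 : ℕ) : ℝ) ^ ((5 : ℝ) / 2) = ((n : ℝ) + 3) ^ 2 * √((n : ℝ) + 3) := by
    rw [show (5 : ℝ) / 2 = 2 + 1 / 2 by norm_num, Real.rpow_add (by positivity), Real.rpow_two,
      ← Real.sqrt_eq_rpow]
    push_cast
    rfl
  have h8 : (8 : ℝ) ^ (n + 3) = 128 * (2 ^ n * 4 ^ (n + 1)) := by
    have : (8 : ℝ) ^ n = 2 ^ n * 4 ^ n := by
      rw [← mul_pow]
      norm_num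
    rw [pow_add, this]
    ring
  rw [avoidCoeff_three, growthInv, hp, Real.sqrt_div (by positivity), h8]
  push_cast
  field_simp
  ring

theorem tendsto_avoidCount :
    Tendsto (fun n => (avoidCount patt1342 n : ℝ) * growthInv n) atTop
      (𝓝 (64 / (243 * √Real.pi))) := by
  have h := tendsto_of_add_succ (avoidCoeff_succ 0) <| tendsto_of_add_succ (avoidCoeff_succ 1) <|
    tendsto_of_add_succ (avoidCoeff_succ 2) tendsto_avoidCoeff_three
  have e : 8 / 9 * (8 / 9 * (8 / 9 * (3 / (8 * √Real.pi)))) = 64 / (243 * √Real.pi) := by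
    field_simp
    norm_num
  rw [e] at h
  simpa [avoidCoeff, avoidGF] using h

end Asymptotics

end Bona

/-- Bóna: `s_n(1342) ~ (64/(243√π)) ⬝ 8ⁿ ⬝ n^(-5/2)` as `n → ∞`. -/
theorem stmt_10 :
    Tendsto (fun n : ℕ =>
        (avoidCount patt1342 n : ℝ) * (243 * Real.sqrt Real.pi * (n : ℝ) ^ ((5 : ℝ) / 2)) /
          (64 * 8 ^ n))
      atTop (nhds 1) := by
  have h := Bona.tendsto_avoidCount.mul_const (243 * √Real.pi / 64)
  have e : 64 / (243 * √Real.pi) * (243 * √Real.pi / 64) = 1 := by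
    field_simp
  rw [e] at h
  refine h.congr fun n => ?_
  rw [Bona.growthInv]
  field_simp
end

section
/- (Regev) The number s_n(12345) of permutations of {1,…,n} avoiding the pattern 12345 satisfies the asymptotic formula s_n(12345) ∼ C · 16^n · n^{−15/2} as n → ∞, where C = 3·2^9/π^{3/2}; that is, lim_{n→∞} s_n(12345) · π^{3/2} · n^{15/2} / (3·2^9 · 16^n) = 1. -/
open Filter

/-- The pattern `12345`, i.e. the identity permutation of `{1,…,5}`. -/
def patt12345 : Equiv.Perm (Fin 5) := Equiv.refl (Fin 5)

/-- `Adds t a b`: the shape `b` (a weakly decreasing sequence of four column lengths) arises from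
the shape `a` by adding a box to a column of length `t`. -/
def Adds (t : ℕ) (a b : Fin 4 → ℕ) : Prop :=
  Antitone a ∧ Antitone b ∧ ∃ c, a c = t ∧ b = a + Pi.single c 1

/-- `Step a b`: the shapes `a` and `b` are equal, or `b` arises from `a` by adding a box. -/
def Step (a b : Fin 4 → ℕ) : Prop :=
  Antitone a ∧ Antitone b ∧ (a = b ∨ ∃ c, b = a + Pi.single c 1)

theorem Adds.step {t : ℕ} {a b : Fin 4 → ℕ} (h : Adds t a b) : Step a b :=
  ⟨h.1, h.2.1, Or.inr (h.2.2.imp fun _ hc => hc.2)⟩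

theorem Adds.ne {t : ℕ} {a b : Fin 4 → ℕ} (h : Adds t a b) : a ≠ b := by
  obtain ⟨-, -, c, -, rfl⟩ := h
  intro h
  have := congrFun h c
  simp at this

theorem Step.refl {a : Fin 4 → ℕ} (h : Antitone a) : Step a a := ⟨h, h, Or.inl rfl⟩

theorem Step.exists_adds {a b : Fin 4 → ℕ} (h : Step a b) (hne : a ≠ b) : ∃ t, Adds t a b := by
  obtain ⟨ha, hb, h | ⟨c, hc⟩⟩ := h
  · exact absurd h hne
  · exact ⟨a c, ha, hb, c, rfl, hc⟩

theorem Step.le {a b : Fin 4 → ℕ} (h : Step a b) : a ≤ b := by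
  obtain ⟨-, -, rfl | ⟨c, rfl⟩⟩ := h
  · exact le_rfl
  · exact le_self_add

theorem Adds.right_unique {t : ℕ} {a b b' : Fin 4 → ℕ} (h : Adds t a b) (h' : Adds t a b') :
    b = b' := by
  obtain ⟨ha, hb, c, hc, rfl⟩ := h
  obtain ⟨-, hb', d, hd, rfl⟩ := h'
  rcases lt_trichotomy c d with hlt | rfl | hlt
  · have := hb' hlt.le
    simp [hlt.ne, hc, hd] at this
  · rfl
  · have := hb hlt.le
    simp [hlt.ne, hc, hd] at this

theorem Adds.left_unique {t : ℕ} {a a' b : Fin 4 → ℕ} (h : Adds t a b) (h' : Adds t a' b) :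
    a = a' := by
  obtain ⟨ha, hb, c, hc, rfl⟩ := h
  obtain ⟨ha', -, d, hd, he⟩ := h'
  have h1 := congrFun he c
  have h2 := congrFun he d
  rcases lt_trichotomy c d with hlt | rfl | hlt
  · have := ha hlt.le
    simp [hlt.ne, hlt.ne', hc, hd] at this h1 h2
    omega
  · exact add_right_cancel he
  · have := ha' hlt.le
    simp [hlt.ne, hlt.ne', hc, hd] at this h1 h2
    omega

theorem Adds.value_unique {t t' : ℕ} {a b : Fin 4 → ℕ} (h : Adds t a b) (h' : Adds t' a b) :
    t = t' := by
  obtain ⟨-, -, c, hc, rfl⟩ := h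
  obtain ⟨-, -, d, hd, he⟩ := h'
  have h1 := congrFun he c
  by_cases hcd : c = d
  · rw [← hc, ← hd, hcd]
  · simp [hcd] at h1

theorem exists_adds_right {a : Fin 4 → ℕ} (ha : Antitone a) (c : Fin 4) :
    ∃ b, Adds (a c) a b := by
  classical
  let s := Finset.univ.filter fun d => a d = a c
  have hs : s.Nonempty := ⟨c, by simp [s]⟩
  have hd : a (s.min' hs) = a c := by
    have := s.min'_mem hs
    simpa [s] using this
  refine ⟨a + Pi.single (s.min' hs) 1, ha, ?_, s.min' hs, hd, rfl⟩
  intro x y hxy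
  have h1 := ha hxy
  by_cases hy : y = s.min' hs
  · by_cases hx : x = y
    · rw [hx]
    · have hlt : x < s.min' hs := hy ▸ lt_of_le_of_ne hxy hx
      have : a x ≠ a c := fun h => absurd (s.min'_le x (by simp [s, h])) (not_le.2 hlt)
      have h3 : x ≠ s.min' hs := hlt.ne
      simp only [Pi.add_apply, hy, Pi.single_eq_same, Pi.single_eq_of_ne h3]
      rw [hy] at h1
      omega
  · simp only [Pi.add_apply, Pi.single_eq_of_ne hy]
    omega

theorem exists_adds_left {b : Fin 4 → ℕ} (hb : Antitone b) {t : ℕ} (c : Fin 4)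
    (hc : b c = t + 1) : ∃ a, Adds t a b := by
  classical
  let s := Finset.univ.filter fun d => b d = t + 1
  have hs : s.Nonempty := ⟨c, by simp [s, hc]⟩
  have hd : b (s.max' hs) = t + 1 := by
    have := s.max'_mem hs
    simpa [s] using this
  have he : b = b - Pi.single (s.max' hs) 1 + Pi.single (s.max' hs) 1 := by
    ext x
    by_cases hx : x = s.max' hs
    · simp [hx, hd]
    · simp [hx]
  refine ⟨b - Pi.single (s.max' hs) 1, ?_, hb, s.max' hs, by simp [hd], he⟩
  intro x y hxy
  have h1 := hb hxy
  by_cases hx : x = s.max' hs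
  · by_cases hy : x = y
    · rw [hy]
    · have hlt : s.max' hs < y := hx ▸ lt_of_le_of_ne hxy hy
      have : b y ≠ t + 1 := fun h => absurd (s.le_max' y (by simp [s, h])) (not_le.2 hlt)
      have h3 : y ≠ s.max' hs := hlt.ne'
      simp only [Pi.sub_apply, hx, Pi.single_eq_same, Pi.single_eq_of_ne h3]
      rw [hx] at h1
      omega
  · simp only [Pi.sub_apply, Pi.single_eq_of_ne hx]
    omega

theorem Step.sup_inf {l a b : Fin 4 → ℕ} (ha : Step l a) (hb : Step l b) (hne : a ≠ b) :
    l = a ⊓ b ∧ Step a (a ⊔ b) ∧ Step b (a ⊔ b) := by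
  have hs : Antitone (a ⊔ b) := ha.2.1.sup hb.2.1
  obtain ⟨hl, ha', rfl | ⟨c, rfl⟩⟩ := ha
  · rw [inf_eq_left.2 hb.le, sup_eq_right.2 hb.le]
    exact ⟨rfl, hb, Step.refl hb.2.1⟩
  obtain ⟨-, hb', rfl | ⟨d, rfl⟩⟩ := hb
  · rw [inf_eq_right.2 le_self_add, sup_eq_left.2 le_self_add]
    exact ⟨rfl, Step.refl ha', ⟨hl, ha', Or.inr ⟨c, rfl⟩⟩⟩
  have hcd : c ≠ d := fun h => hne (by rw [h])
  have key : ∀ x, (Pi.single c 1 : Fin 4 → ℕ) x = 0 ∨ (Pi.single d 1 : Fin 4 → ℕ) x = 0 := by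
    intro x
    by_cases hx : x = c
    · right; rw [hx]; exact Pi.single_eq_of_ne hcd 1
    · left; exact Pi.single_eq_of_ne hx 1
  refine ⟨?_, ⟨ha', hs, Or.inr ⟨d, ?_⟩⟩, ⟨hb', hs, Or.inr ⟨c, ?_⟩⟩⟩ <;> ext x <;>
    have := key x <;> simp only [Pi.add_apply, Pi.inf_apply, Pi.sup_apply] <;> omega

theorem Step.inf_sup {a b r : Fin 4 → ℕ} (ha : Step a r) (hb : Step b r) (hne : a ≠ b) :
    r = a ⊔ b ∧ Step (a ⊓ b) a ∧ Step (a ⊓ b) b := by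
  have hs : Antitone (a ⊓ b) := ha.1.inf hb.1
  obtain ⟨ha', hr, rfl | ⟨c, rfl⟩⟩ := ha
  · rw [inf_eq_right.2 hb.le, sup_eq_left.2 hb.le]
    exact ⟨rfl, hb, Step.refl hb.1⟩
  obtain ⟨hb', -, rfl | ⟨d, he⟩⟩ := hb
  · rw [inf_eq_left.2 le_self_add, sup_eq_right.2 le_self_add]
    exact ⟨rfl, Step.refl ha', ⟨ha', hr, Or.inr ⟨c, rfl⟩⟩⟩
  have hcd : c ≠ d := by
    rintro rfl
    exact hne (add_right_cancel he)
  have key : ∀ x, ((Pi.single c 1 : Fin 4 → ℕ) x = 0 ∨ (Pi.single d 1 : Fin 4 → ℕ) x = 0) ∧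
      (Pi.single c 1 : Fin 4 → ℕ) x ≤ 1 ∧ (Pi.single d 1 : Fin 4 → ℕ) x ≤ 1 ∧
      a x + (Pi.single c 1 : Fin 4 → ℕ) x = b x + (Pi.single d 1 : Fin 4 → ℕ) x := by
    intro x
    refine ⟨?_, ?_, ?_, congrFun he x⟩
    · by_cases hx : x = c
      · right; rw [hx]; exact Pi.single_eq_of_ne hcd 1
      · left; exact Pi.single_eq_of_ne hx 1
    all_goals simp only [Pi.single_apply]; split_ifs <;> simp
  refine ⟨?_, ⟨hs, ha', Or.inr ⟨d, ?_⟩⟩, ⟨hs, hb', Or.inr ⟨c, ?_⟩⟩⟩ <;> ext x <;>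
    have := key x <;> simp only [Pi.add_apply, Pi.inf_apply, Pi.sup_apply] <;> omega

/-- The local rule of growth diagrams: `l`, `a`, `b`, `r` are the shapes at the four corners of a
unit cell, which carries a mark when `m` holds. -/
def Cell (l a b r : Fin 4 → ℕ) (m : Prop) : Prop :=
  Step l a ∧ Step l b ∧ Step a r ∧ Step b r ∧
    ((¬ m ∧ a ≠ b ∧ l = a ⊓ b ∧ r = a ⊔ b) ∨ (¬ m ∧ l = a ∧ a = b ∧ b = r) ∨
      (m ∧ l = a ∧ a = b ∧ Adds 0 a r) ∨ (¬ m ∧ a = b ∧ ∃ t, Adds t l a ∧ Adds (t + 1) a r))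

theorem exists_cell_right {l a b : Fin 4 → ℕ} {m : Prop} (ha : Step l a) (hb : Step l b)
    (hm : m → l = a ∧ a = b ∧ l 3 = 0) : ∃ r, Cell l a b r m := by
  by_cases hab : a = b
  · subst hab
    by_cases h : m
    · obtain ⟨rfl, -, h0⟩ := hm h
      obtain ⟨r, hr⟩ := exists_adds_right ha.1 3
      rw [h0] at hr
      exact ⟨r, ha, ha, hr.step, hr.step, Or.inr (Or.inr (Or.inl ⟨h, rfl, rfl, hr⟩))⟩
    · by_cases hla : l = a
      · subst hla
        exact ⟨l, ha, ha, ha, ha, Or.inr (Or.inl ⟨h, rfl, rfl, rfl⟩)⟩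
      · obtain ⟨t, ht⟩ := ha.exists_adds hla
        obtain ⟨c, hc, e⟩ := ht.2.2
        obtain ⟨r, hr⟩ := exists_adds_right ha.2.1 c
        have : a c = t + 1 := by rw [e]; simp [hc]
        rw [this] at hr
        exact ⟨r, ha, ha, hr.step, hr.step, Or.inr (Or.inr (Or.inr ⟨h, rfl, t, ht, hr⟩))⟩
  · obtain ⟨h1, h2, h3⟩ := ha.sup_inf hb hab
    exact ⟨a ⊔ b, ha, hb, h2, h3, Or.inl ⟨fun h => hab (hm h).2.1, hab, h1, rfl⟩⟩

theorem exists_cell_left {a b r : Fin 4 → ℕ} (ha : Step a r) (hb : Step b r) :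
    ∃ l m, Cell l a b r m := by
  by_cases hab : a = b
  · subst hab
    by_cases har : a = r
    · subst har
      exact ⟨a, False, ha, ha, ha, ha, Or.inr (Or.inl ⟨not_false, rfl, rfl, rfl⟩)⟩
    · obtain ⟨t, ht⟩ := ha.exists_adds har
      obtain ⟨c, hc, e⟩ := ht.2.2
      rcases t with _ | t
      · exact ⟨a, True, Step.refl ha.1, Step.refl ha.1, ha, ha,
          Or.inr (Or.inr (Or.inl ⟨trivial, rfl, rfl, ht⟩))⟩
      · obtain ⟨l, hl⟩ := exists_adds_left ha.1 c hc
        exact ⟨l, False, hl.step, hl.step, ha, ha,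
          Or.inr (Or.inr (Or.inr ⟨not_false, rfl, t, hl, ht⟩))⟩
  · obtain ⟨h1, h2, h3⟩ := ha.inf_sup hb hab
    exact ⟨a ⊓ b, False, h2, h3, ha, hb, Or.inl ⟨not_false, hab, rfl, h1⟩⟩

theorem Cell.right_unique {l a b r r' : Fin 4 → ℕ} {m : Prop} (h : Cell l a b r m)
    (h' : Cell l a b r' m) : r = r' := by
  obtain ⟨-, -, -, -, h⟩ := h
  obtain ⟨-, -, -, -, h'⟩ := h'
  rcases h with ⟨h1, h2, h3, h4⟩ | ⟨h1, h2, h3, h4⟩ | ⟨h1, h2, h3, h4⟩ | ⟨h1, h2, t, h3, h4⟩ <;>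
  rcases h' with ⟨k1, k2, k3, k4⟩ | ⟨k1, k2, k3, k4⟩ | ⟨k1, k2, k3, k4⟩ | ⟨k1, k2, t', k3, k4⟩ <;>
  first
  | exact absurd ‹a = b› ‹a ≠ b›
  | exact absurd ‹m› ‹¬ m›
  | exact h4.trans k4.symm
  | exact h4.symm.trans k4
  | exact absurd ‹l = a› (Adds.ne ‹_›)
  | exact h4.right_unique k4
  | exact h4.right_unique (by rwa [h3.value_unique k3])

theorem Cell.left_unique {l l' a b r : Fin 4 → ℕ} {m m' : Prop} (h : Cell l a b r m)
    (h' : Cell l' a b r m') : l = l' ∧ (m ↔ m') := by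
  obtain ⟨-, -, -, -, h⟩ := h
  obtain ⟨-, -, -, -, h'⟩ := h'
  rcases h with ⟨h1, h2, h3, h4⟩ | ⟨h1, h2, h3, h4⟩ | ⟨h1, h2, h3, h4⟩ | ⟨h1, h2, t, h3, h4⟩ <;>
  rcases h' with ⟨k1, k2, k3, k4⟩ | ⟨k1, k2, k3, k4⟩ | ⟨k1, k2, k3, k4⟩ | ⟨k1, k2, t', k3, k4⟩ <;>
  first
  | exact absurd ‹a = b› ‹a ≠ b›
  | exact ⟨h3.trans k3.symm, iff_of_false h1 k1⟩
  | exact ⟨h2.trans k2.symm, iff_of_false h1 k1⟩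
  | exact ⟨h2.trans k2.symm, iff_of_true h1 k1⟩
  | exact absurd (h3.trans h4) k4.ne
  | exact absurd (k3.trans k4) h4.ne
  | exact absurd (h4.value_unique k4) (by omega)
  | (obtain rfl : t = t' := by have := h4.value_unique k4; omega
     exact ⟨h3.left_unique k3, iff_of_false h1 k1⟩)

theorem Cell.symm {l a b r : Fin 4 → ℕ} {m : Prop} (h : Cell l a b r m) : Cell l b a r m := by
  obtain ⟨s1, s2, s3, s4, h⟩ := h
  refine ⟨s2, s1, s4, s3, ?_⟩
  rcases h with ⟨h1, h2, h3, h4⟩ | ⟨h1, h2, h3, h4⟩ | ⟨h1, h2, h3, h4⟩ | ⟨h1, h2, t, h3, h4⟩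
  · exact Or.inl ⟨h1, h2.symm, by rw [h3, inf_comm], by rw [h4, sup_comm]⟩
  · exact Or.inr (Or.inl ⟨h1, h2.trans h3, h3.symm, h3.trans h4⟩)
  · exact Or.inr (Or.inr (Or.inl ⟨h1, h2.trans h3, h3.symm, h3 ▸ h4⟩))
  · exact Or.inr (Or.inr (Or.inr ⟨h1, h2.symm, t, h2 ▸ h3, h2 ▸ h4⟩))

theorem Cell.eq_iff {l a b r : Fin 4 → ℕ} {m : Prop} (h : Cell l a b r m) (hm : ¬ m) :
    l = b ↔ a = r := by
  obtain ⟨-, -, -, -, h⟩ := h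
  rcases h with ⟨h1, h2, h3, h4⟩ | ⟨h1, h2, h3, h4⟩ | ⟨h1, h2, h3, h4⟩ | ⟨h1, h2, t, h3, h4⟩
  · rw [h3, h4, inf_eq_right, left_eq_sup]
  · exact iff_of_true (h2.trans h3) (h3.trans h4)
  · exact absurd h1 hm
  · exact iff_of_false (h2 ▸ h3.ne) h4.ne

theorem Cell.of_mark {l a b r : Fin 4 → ℕ} {m : Prop} (h : Cell l a b r m) (hm : m) :
    l = b ∧ a ≠ r ∧ l 3 = 0 ∧ Adds 0 l r := by
  obtain ⟨-, -, -, -, h⟩ := h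
  rcases h with ⟨h1, h2, h3, h4⟩ | ⟨h1, h2, h3, h4⟩ | ⟨h1, h2, h3, h4⟩ | ⟨h1, h2, t, h3, h4⟩
  · exact absurd hm h1
  · exact absurd hm h1
  · obtain ⟨c, hc, -⟩ := h4.2.2
    refine ⟨h2.trans h3, h4.ne, ?_, h2 ▸ h4⟩
    have := h4.1 (Fin.le_last c)
    rw [h2]
    simpa [hc] using this
  · exact absurd hm h1

theorem Cell.pos_iff_of_not_mark {l a b r : Fin 4 → ℕ} {m : Prop} (h : Cell l a b r m)
    (hm : ¬ m) (k : Fin 4) : 0 < r k ↔ 0 < a k ∨ 0 < b k := by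
  obtain ⟨-, -, -, -, h⟩ := h
  rcases h with ⟨h1, h2, h3, h4⟩ | ⟨h1, h2, h3, h4⟩ | ⟨h1, h2, h3, h4⟩ | ⟨h1, h2, t, h3, h4⟩
  · rw [h4, Pi.sup_apply, lt_sup_iff]
  · rw [← h4, h3, or_self]
  · exact absurd h1 hm
  · obtain ⟨-, -, c, hc, rfl⟩ := h4
    rw [← h2, or_self]
    by_cases hk : k = c
    · simp [hk, hc]
    · simp [hk]

theorem Adds.pos_iff {l r : Fin 4 → ℕ} (h : Adds 0 l r) (k : Fin 4) :
    0 < r k ↔ ∀ i : Fin 4, i < k → 0 < l i := by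
  obtain ⟨ha, hb, c, hc, rfl⟩ := h
  have hlt : ∀ i, i < c → 0 < l i := by
    intro i hi
    have := hb hi.le
    simp [hi.ne, hc] at this
    omega
  have hge : ∀ i, c ≤ i → l i = 0 := fun i hi => by simpa [hc] using ha hi
  rcases lt_trichotomy k c with h | rfl | h
  · simp only [Pi.add_apply, Pi.single_eq_of_ne h.ne]
    refine iff_of_true (by have := hlt k h; omega) fun i hi => hlt i (hi.trans h)
  · exact iff_of_true (by simp) hlt
  · refine iff_of_false ?_ fun hh => by have := hh c h; omega
    simp [h.ne', hge k h.le]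

/-- `IncChain M k i j`: the marks of `M` in the rectangle `[0, i) × [0, j)` contain a chain of
length `k` which increases strictly in both coordinates. -/
def IncChain (M : ℕ → ℕ → Prop) : ℕ → ℕ → ℕ → Prop
  | 0, _, _ => True
  | k + 1, i, j => ∃ p < i, ∃ q < j, M p q ∧ IncChain M k p q

theorem IncChain.mono {M : ℕ → ℕ → Prop} {k k' i i' j j' : ℕ} (h : IncChain M k i j)
    (hk : k' ≤ k) (hi : i ≤ i') (hj : j ≤ j') : IncChain M k' i' j' := by
  induction k' generalizing k i i' j j' with
  | zero => trivial
  | succ k' ih =>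
    obtain ⟨k, rfl⟩ : ∃ l, k = l + 1 := ⟨k - 1, by omega⟩
    obtain ⟨p, hp, q, hq, hM, hc⟩ := h
    exact ⟨p, hp.trans_le hi, q, hq.trans_le hj, hM, ih hc (by omega) le_rfl le_rfl⟩

theorem incChain_succ_of_mark {M : ℕ → ℕ → Prop} {k i j : ℕ} (h : M i j) :
    IncChain M (k + 1) (i + 1) (j + 1) ↔ IncChain M k i j := by
  constructor
  · rintro ⟨p, hp, q, hq, -, hc⟩
    exact hc.mono le_rfl (by omega) (by omega)
  · intro hc
    exact ⟨i, by omega, j, by omega, h, hc⟩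

theorem incChain_succ_of_not_mark {M : ℕ → ℕ → Prop} {k i j : ℕ} (h : ¬ M i j) :
    IncChain M (k + 1) (i + 1) (j + 1) ↔
      IncChain M (k + 1) i (j + 1) ∨ IncChain M (k + 1) (i + 1) j := by
  constructor
  · rintro ⟨p, hp, q, hq, hM, hc⟩
    by_cases hpi : p < i
    · exact Or.inl ⟨p, hpi, q, hq, hM, hc⟩
    · obtain rfl : p = i := by omega
      have : q ≠ j := fun e => h (e ▸ hM)
      exact Or.inr ⟨p, hp, q, by omega, hM, hc⟩
  · rintro (h | h)
    · exact h.mono le_rfl (by omega) le_rfl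
    · exact h.mono le_rfl le_rfl (by omega)

/-- The grid of shapes `G` obeys the local rule in the unit cell with lower left corner `(i, j)`. -/
def CellAt (M : ℕ → ℕ → Prop) (G : ℕ → ℕ → Fin 4 → ℕ) (i j : ℕ) : Prop :=
  Cell (G i j) (G i (j + 1)) (G (i + 1) j) (G (i + 1) (j + 1)) (M i j)

theorem CellAt.swap {M : ℕ → ℕ → Prop} {G : ℕ → ℕ → Fin 4 → ℕ} {i j : ℕ} (h : CellAt M G i j) :
    CellAt (fun i j => M j i) (fun i j => G j i) j i := Cell.symm h

theorem pos_iff_incChain {M : ℕ → ℕ → Prop} {G : ℕ → ℕ → Fin 4 → ℕ} {I J : ℕ}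
    (h : ∀ p < I, ∀ q < J, CellAt M G p q) (h0 : ∀ j, G 0 j = 0) (h0' : ∀ i, G i 0 = 0) :
    ∀ i ≤ I, ∀ j ≤ J, ∀ k : Fin 4, 0 < G i j k ↔ IncChain M (k + 1) i j := by
  intro i
  induction i with
  | zero =>
    intro _ j _ k
    simp [h0, IncChain]
  | succ i ihi =>
    intro hi j
    induction j with
    | zero =>
      intro _ k
      simp [h0', IncChain]
    | succ j ihj =>
      intro hj k
      have hc := h i hi j hj
      by_cases hM : M i j
      · rw [(hc.of_mark hM).2.2.2.pos_iff, incChain_succ_of_mark hM]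
        simp only [ihi (by omega) j (by omega)]
        constructor
        · intro hall
          obtain ⟨k, hk⟩ := k
          rcases k with _ | k
          · trivial
          · exact hall ⟨k, by omega⟩ (Fin.mk_lt_mk.2 (Nat.lt_succ_self k))
        · intro hk l hl
          exact hk.mono (Fin.lt_def.1 hl) le_rfl le_rfl
      · rw [hc.pos_iff_of_not_mark hM, incChain_succ_of_not_mark hM,
          ihi (by omega) (j + 1) hj, ihj (by omega)]

theorem grid_eq_right {M : ℕ → ℕ → Prop} {G : ℕ → ℕ → Fin 4 → ℕ} {i : ℕ} (h0' : ∀ i, G i 0 = 0)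
    (j : ℕ) (h : ∀ q < j, CellAt M G i q) (hM : ∀ q < j, ¬ M i q) : G i j = G (i + 1) j := by
  induction j with
  | zero => rw [h0', h0']
  | succ j ih =>
    exact ((h j (by omega)).eq_iff (hM j (by omega))).1
      (ih (fun q hq => h q (by omega)) (fun q hq => hM q (by omega)))

theorem grid_ne_right {M : ℕ → ℕ → Prop} {G : ℕ → ℕ → Fin 4 → ℕ} {i j : ℕ} (hM : M i j)
    (h' : ∀ q, M i q → q = j)
    (j' : ℕ) (h : ∀ q < j', CellAt M G i q) (hj : j < j') : G i j' ≠ G (i + 1) j' := by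
  induction j', hj using Nat.le_induction with
  | base => exact ((h j (by omega)).of_mark hM).2.1
  | succ n hn ih =>
    have : ¬ M i n := fun e => by have := h' n e; omega
    rw [Ne, ← (h n (by omega)).eq_iff this]
    exact ih fun q hq => h q (by omega)

theorem grid_step_right {M : ℕ → ℕ → Prop} {G : ℕ → ℕ → Fin 4 → ℕ} {i : ℕ} (h0' : ∀ i, G i 0 = 0)
    (j : ℕ) (h : ∀ q < j, CellAt M G i q) : Step (G i j) (G (i + 1) j) := by
  rcases j with _ | j
  · rw [h0', h0']
    exact Step.refl antitone_const
  · exact (h j (by omega)).2.2.1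

/-- The growth diagram of the set of marks `M`. -/
noncomputable def growth (M : ℕ → ℕ → Prop) : ℕ → ℕ → Fin 4 → ℕ
  | 0, _ => 0
  | _ + 1, 0 => 0
  | i + 1, j + 1 => Classical.epsilon fun r =>
      Cell (growth M i j) (growth M i (j + 1)) (growth M (i + 1) j) r (M i j)

theorem growth_zero_left (M : ℕ → ℕ → Prop) (j : ℕ) : growth M 0 j = 0 := by rw [growth]

theorem growth_zero_right (M : ℕ → ℕ → Prop) (i : ℕ) : growth M i 0 = 0 := by
  cases i <;> rw [growth]

theorem growth_cellAt {M : ℕ → ℕ → Prop} (h1 : ∀ i j j', M i j → M i j' → j = j')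
    (h2 : ∀ i i' j, M i j → M i' j → i = i') (h5 : ∀ i j, ¬ IncChain M 5 i j) (i j : ℕ) :
    CellAt M (growth M) i j := by
  have g0 := growth_zero_left M
  have g0' := growth_zero_right M
  induction i using Nat.strong_induction_on generalizing j with
  | _ i ihi =>
  induction j using Nat.strong_induction_on with
  | _ j ihj =>
  have s1 : Step (growth M i j) (growth M (i + 1) j) := grid_step_right g0' j ihj
  have s2 : Step (growth M i j) (growth M i (j + 1)) :=
    grid_step_right (G := fun i j => growth M j i) g0 i fun p hp => (ihi p hp j).swap
  have key : ∃ r, Cell (growth M i j) (growth M i (j + 1)) (growth M (i + 1) j) r (M i j) := by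
    refine exists_cell_right s2 s1 fun hM => ?_
    have e1 : growth M i j = growth M (i + 1) j := grid_eq_right g0' j ihj
      fun q hq hq' => by have := h1 _ _ _ hM hq'; omega
    have e2 : growth M i j = growth M i (j + 1) :=
      grid_eq_right (G := fun i j => growth M j i) g0 i (fun p hp => (ihi p hp j).swap)
        fun p hp hp' => by have := h2 _ _ _ hM hp'; omega
    refine ⟨e2, e2.symm.trans e1, ?_⟩
    by_contra hne
    have := (pos_iff_incChain (fun p hp q _ => ihi p hp q) g0 g0' i le_rfl j le_rfl 3).1 (by omega)
    exact h5 (i + 1) (j + 1) ((incChain_succ_of_mark hM).2 this)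
  have := Classical.epsilon_spec key
  rw [CellAt]
  conv => arg 4; rw [growth]
  exact this

theorem grid_forward_unique {M : ℕ → ℕ → Prop} {G G' : ℕ → ℕ → Fin 4 → ℕ} {I J : ℕ}
    (h : ∀ p < I, ∀ q < J, CellAt M G p q) (h' : ∀ p < I, ∀ q < J, CellAt M G' p q)
    (h0 : ∀ j, G 0 j = G' 0 j) (h0' : ∀ i, G i 0 = G' i 0) :
    ∀ i ≤ I, ∀ j ≤ J, G i j = G' i j := by
  intro i
  induction i with
  | zero => exact fun _ j _ => h0 j
  | succ i ihi =>
    intro hi j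
    induction j with
    | zero => exact fun _ => h0' _
    | succ j ihj =>
      intro hj
      have c := h i hi j hj
      have c' := h' i hi j hj
      rw [CellAt] at c c'
      rw [← ihi (by omega) j (by omega), ← ihi (by omega) (j + 1) hj, ← ihj (by omega)] at c'
      exact c.right_unique c'

theorem grid_backward_unique {M M' : ℕ → ℕ → Prop} {G G' : ℕ → ℕ → Fin 4 → ℕ} {n : ℕ}
    (h : ∀ p q, CellAt M G p q) (h' : ∀ p q, CellAt M' G' p q)
    (h0 : ∀ j, G n j = G' n j) (h0' : ∀ i, G i n = G' i n) :
    (∀ i ≤ n, ∀ j ≤ n, G i j = G' i j) ∧ ∀ i < n, ∀ j < n, (M i j ↔ M' i j) := by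
  have key : ∀ a i, i + a = n → ∀ b j, j + b = n → G i j = G' i j := by
    intro a
    induction a with
    | zero =>
      intro i hi b j _
      obtain rfl : i = n := by omega
      exact h0 j
    | succ a iha =>
      intro i hi b
      induction b with
      | zero =>
        intro j hj
        obtain rfl : j = n := by omega
        exact h0' i
      | succ b ihb =>
        intro j hj
        have c := h i j
        have c' := h' i j
        rw [CellAt] at c c'
        rw [← ihb (j + 1) (by omega), ← iha (i + 1) (by omega) (b + 1) j hj,
          ← iha (i + 1) (by omega) b (j + 1) (by omega)] at c'
        exact (c.left_unique c').1
  have key' : ∀ i ≤ n, ∀ j ≤ n, G i j = G' i j := fun i hi j hj =>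
    key (n - i) i (by omega) (n - j) j (by omega)
  refine ⟨key', fun i hi j hj => ?_⟩
  have c := h i j
  have c' := h' i j
  rw [CellAt] at c c'
  rw [← key' i hi.le (j + 1) hj, ← key' (i + 1) hi j hj.le, ← key' (i + 1) hi (j + 1) hj] at c'
  exact (c.left_unique c').2

/-- The grid of shapes with prescribed boundary chains `p` and `q`; the arguments count the steps
away from the corner where the two chains meet. -/
noncomputable def shrink (n : ℕ) (p q : ℕ → Fin 4 → ℕ) : ℕ → ℕ → Fin 4 → ℕ
  | 0, b => p (n - b)
  | a + 1, 0 => q (n - (a + 1))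
  | a + 1, b + 1 => Classical.epsilon fun l =>
      ∃ m, Cell l (shrink n p q (a + 1) b) (shrink n p q a (b + 1)) (shrink n p q a b) m

/-- A standard filling of the shape `l`, as an increasing chain of shapes that becomes constant
after `n` steps. -/
def ShapeChain (n : ℕ) (l : Fin 4 → ℕ) (p : ℕ → Fin 4 → ℕ) : Prop :=
  p 0 = 0 ∧ (∀ j < n, Step (p j) (p (j + 1)) ∧ p j ≠ p (j + 1)) ∧ ∀ j, n ≤ j → p j = l

theorem ShapeChain.step {n : ℕ} {l : Fin 4 → ℕ} {p : ℕ → Fin 4 → ℕ} (h : ShapeChain n l p)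
    (b : ℕ) : Step (p (n - (b + 1))) (p (n - b)) := by
  by_cases hb : b < n
  · have := (h.2.1 (n - (b + 1)) (by omega)).1
    rwa [show n - (b + 1) + 1 = n - b by omega] at this
  · rw [show n - (b + 1) = 0 by omega, show n - b = 0 by omega, h.1]
    exact Step.refl antitone_const

theorem shrink_zero_right {n : ℕ} {l : Fin 4 → ℕ} {p q : ℕ → Fin 4 → ℕ} (hp : ShapeChain n l p)
    (hq : ShapeChain n l q) (a : ℕ) : shrink n p q a 0 = q (n - a) := by
  rcases a with _ | a
  · rw [shrink, Nat.sub_zero, hp.2.2 n le_rfl, hq.2.2 n le_rfl]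
  · rw [shrink]

theorem shrink_cell {n : ℕ} {l : Fin 4 → ℕ} {p q : ℕ → Fin 4 → ℕ} (hp : ShapeChain n l p)
    (hq : ShapeChain n l q) (a b : ℕ) :
    ∃ m, Cell (shrink n p q (a + 1) (b + 1)) (shrink n p q (a + 1) b) (shrink n p q a (b + 1))
      (shrink n p q a b) m := by
  induction a using Nat.strong_induction_on generalizing b with
  | _ a iha =>
  induction b using Nat.strong_induction_on with
  | _ b ihb =>
  have s1 : Step (shrink n p q (a + 1) b) (shrink n p q a b) := by
    rcases b with _ | b
    · rw [shrink_zero_right hp hq, shrink_zero_right hp hq]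
      exact hq.step a
    · obtain ⟨m, hm⟩ := ihb b (Nat.lt_succ_self b)
      exact hm.2.1
  have s2 : Step (shrink n p q a (b + 1)) (shrink n p q a b) := by
    rcases a with _ | a
    · rw [shrink, shrink]
      exact hp.step b
    · obtain ⟨m, hm⟩ := iha a (Nat.lt_succ_self a) b
      exact hm.1
  have := Classical.epsilon_spec (exists_cell_left s1 s2)
  conv => arg 1; ext m; arg 1; rw [shrink]
  exact this

theorem grid_exists_mark {M : ℕ → ℕ → Prop} {G : ℕ → ℕ → Fin 4 → ℕ} {n i : ℕ}
    (h : ∀ q < n, CellAt M G i q) (h0' : ∀ i, G i 0 = 0) (hne : G i n ≠ G (i + 1) n) :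
    ∃ j < n, M i j := by
  by_contra! hcon
  exact hne (grid_eq_right h0' n h hcon)

theorem grid_mark_unique {M : ℕ → ℕ → Prop} {G : ℕ → ℕ → Fin 4 → ℕ} {n i : ℕ}
    (h : ∀ q < n, CellAt M G i q) {j j' : ℕ} (hj' : j' < n) (hjj' : j < j')
    (hM : M i j) : ¬ M i j' := by
  have key : ∀ m, j < m → m < n → G i m ≠ G (i + 1) m := by
    intro m hm
    induction m, hm using Nat.le_induction with
    | base => exact fun hn => ((h j (by omega)).of_mark hM).2.1
    | succ m hm ih =>
      intro hn
      have ih := ih (by omega)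
      have c := h m (by omega)
      by_cases hm' : M i m
      · exact absurd (c.of_mark hm').1 ih
      · rwa [Ne, ← c.eq_iff hm']
  exact fun hM' => key j' hjj' hj' ((h j' hj').of_mark hM').1

/-- The permutation matrix of `π` as a set of marks. -/
def permMark {n : ℕ} (π : Equiv.Perm (Fin n)) (i j : ℕ) : Prop :=
  ∃ h : i < n, (π ⟨i, h⟩ : ℕ) = j

theorem permMark_lt {n : ℕ} {π : Equiv.Perm (Fin n)} {i j : ℕ} (h : permMark π i j) :
    i < n ∧ j < n := by
  obtain ⟨hi, rfl⟩ := h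
  exact ⟨hi, (π _).2⟩

theorem permMark_right_unique {n : ℕ} {π : Equiv.Perm (Fin n)} (i j j' : ℕ) (h : permMark π i j)
    (h' : permMark π i j') : j = j' := by
  obtain ⟨hi, rfl⟩ := h
  obtain ⟨hi, rfl⟩ := h'
  rfl

theorem permMark_left_unique {n : ℕ} {π : Equiv.Perm (Fin n)} (i i' j : ℕ) (h : permMark π i j)
    (h' : permMark π i' j) : i = i' := by
  obtain ⟨hi, rfl⟩ := h
  obtain ⟨hi', h'⟩ := h'
  have := π.injective (Fin.ext h')
  simpa using this.symm

theorem pattContains_iff_incChain {n : ℕ} (π : Equiv.Perm (Fin n)) :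
    PattContains patt12345 π ↔ IncChain (permMark π) 5 n n := by
  constructor
  · rintro ⟨f, hf, h⟩
    have h' : ∀ a b : Fin 5, a < b → ((π (f a) : Fin n) : ℕ) < π (f b) :=
      fun a b hab => Fin.lt_def.1 ((h a b).2 hab)
    have hf' : ∀ a b : Fin 5, a < b → (f a : ℕ) < f b := fun a b hab => Fin.lt_def.1 (hf hab)
    exact ⟨f 4, (f 4).2, π (f 4), (π (f 4)).2, ⟨(f 4).2, rfl⟩,
      f 3, hf' _ _ (by decide), π (f 3), h' _ _ (by decide), ⟨(f 3).2, rfl⟩,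
      f 2, hf' _ _ (by decide), π (f 2), h' _ _ (by decide), ⟨(f 2).2, rfl⟩,
      f 1, hf' _ _ (by decide), π (f 1), h' _ _ (by decide), ⟨(f 1).2, rfl⟩,
      f 0, hf' _ _ (by decide), π (f 0), h' _ _ (by decide), ⟨(f 0).2, rfl⟩, trivial⟩
  · rintro ⟨p4, hp4, q4, hq4, ⟨l4, rfl⟩, p3, hp3, q3, hq3, ⟨l3, rfl⟩, p2, hp2, q2, hq2, ⟨l2, rfl⟩,
      p1, hp1, q1, hq1, ⟨l1, rfl⟩, p0, hp0, q0, hq0, ⟨l0, rfl⟩, -⟩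
    let f : Fin 5 → Fin n := ![⟨p0, l0⟩, ⟨p1, l1⟩, ⟨p2, l2⟩, ⟨p3, l3⟩, ⟨p4, l4⟩]
    have hf : StrictMono f := by
      rw [Fin.strictMono_iff_lt_succ]
      intro i
      fin_cases i
      exacts [hp0, hp1, hp2, hp3]
    have hg : StrictMono fun a => π (f a) := by
      rw [Fin.strictMono_iff_lt_succ]
      intro i
      fin_cases i
      exacts [hq0, hq1, hq2, hq3]
    exact ⟨f, hf, fun a b => hg.lt_iff_lt⟩

theorem not_incChain_permMark {n : ℕ} {π : Equiv.Perm (Fin n)} (h : ¬ PattContains patt12345 π)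
    (i j : ℕ) : ¬ IncChain (permMark π) 5 i j := by
  rw [pattContains_iff_incChain] at h
  rintro ⟨p, hp, q, hq, hM, hc⟩
  exact h ⟨p, (permMark_lt hM).1, q, (permMark_lt hM).2, hM, hc⟩

theorem growth_shapeChain_right {n : ℕ} {π : Equiv.Perm (Fin n)}
    (h : ∀ i j, CellAt (permMark π) (growth (permMark π)) i j) :
    ShapeChain n (growth (permMark π) n n) fun i => growth (permMark π) i n := by
  refine ⟨growth_zero_left _ _, fun i hi => ⟨?_, ?_⟩, fun i hi => ?_⟩
  · exact grid_step_right (growth_zero_right _) n fun q _ => h i q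
  · exact grid_ne_right (j := (π ⟨i, hi⟩ : ℕ)) ⟨hi, rfl⟩
      (fun q hq => permMark_right_unique _ _ _ hq ⟨hi, rfl⟩) n (fun q _ => h i q) (π ⟨i, hi⟩).2
  · induction i, hi using Nat.le_induction with
    | base => rfl
    | succ i hi ih =>
      rw [← ih]
      exact (grid_eq_right (growth_zero_right _) n (fun q _ => h i q)
        fun q _ hM => by have := (permMark_lt hM).1; omega).symm

theorem growth_shapeChain_left {n : ℕ} {π : Equiv.Perm (Fin n)}
    (h : ∀ i j, CellAt (permMark π) (growth (permMark π)) i j) :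
    ShapeChain n (growth (permMark π) n n) fun j => growth (permMark π) n j := by
  have h' := fun i j => (h j i).swap
  have h0 : ∀ i, (fun i j => growth (permMark π) j i) i 0 = 0 := growth_zero_left _
  refine ⟨growth_zero_right _ _, fun j hj => ⟨?_, ?_⟩, fun j hj => ?_⟩
  · exact grid_step_right (G := fun i j => growth (permMark π) j i) h0 n fun q _ => h' j q
  · have hm : permMark π (π.symm ⟨j, hj⟩) j := ⟨(π.symm ⟨j, hj⟩).2, by simp⟩
    exact grid_ne_right (G := fun i j => growth (permMark π) j i) (M := fun i j => permMark π j i)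
      (j := (π.symm ⟨j, hj⟩ : ℕ)) hm (fun q hq => permMark_left_unique _ _ _ hq hm) n
      (fun q _ => h' j q) (π.symm ⟨j, hj⟩).2
  · induction j, hj using Nat.le_induction with
    | base => rfl
    | succ j hj ih =>
      rw [← ih]
      exact (grid_eq_right (G := fun i j => growth (permMark π) j i) h0 n (fun q _ => h' j q)
        fun q _ hM => by have := (permMark_lt hM).2; omega).symm

/-- Pairs of standard fillings with `n` boxes and the same shape. -/
abbrev ChainPair (n : ℕ) : Type :=
  {pq : (ℕ → Fin 4 → ℕ) × (ℕ → Fin 4 → ℕ) // ∃ l, ShapeChain n l pq.1 ∧ ShapeChain n l pq.2}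

theorem exists_perm_of_chainPair {n : ℕ} {l : Fin 4 → ℕ} {p q : ℕ → Fin 4 → ℕ}
    (hp : ShapeChain n l p) (hq : ShapeChain n l q) :
    ∃ π : Equiv.Perm (Fin n), ¬ PattContains patt12345 π ∧
      (∀ j ≤ n, growth (permMark π) n j = p j) ∧ ∀ i ≤ n, growth (permMark π) i n = q i := by
  let H : ℕ → ℕ → Fin 4 → ℕ := fun i j => shrink n p q (n - i) (n - j)
  let M : ℕ → ℕ → Prop := fun i j =>
    Cell (H i j) (H i (j + 1)) (H (i + 1) j) (H (i + 1) (j + 1)) True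
  have hcell : ∀ i < n, ∀ j < n, CellAt M H i j := by
    intro i hi j hj
    obtain ⟨m, hm⟩ := shrink_cell hp hq (n - (i + 1)) (n - (j + 1))
    rw [show n - (i + 1) + 1 = n - i by omega, show n - (j + 1) + 1 = n - j by omega] at hm
    change Cell (H i j) (H i (j + 1)) (H (i + 1) j) (H (i + 1) (j + 1)) m at hm
    rw [CellAt]
    by_cases h : m
    · rw [eq_true h] at hm
      have : M i j := hm
      rwa [eq_true this]
    · have : ¬ M i j := fun hM => h ((hm.left_unique hM).2.2 trivial)
      rw [eq_false this]
      rwa [eq_false h] at hm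
  have hHn : ∀ j ≤ n, H n j = p j := by
    intro j hj
    simp only [H, Nat.sub_self]
    rw [shrink, show n - (n - j) = j by omega]
  have hnH : ∀ i ≤ n, H i n = q i := by
    intro i hi
    simp only [H, Nat.sub_self]
    rw [shrink_zero_right hp hq, show n - (n - i) = i by omega]
  have hH0 : ∀ i, i ≤ n → H i 0 = 0 := by
    intro i hi
    induction hi using Nat.decreasingInduction with
    | self => rw [hHn 0 (Nat.zero_le n), hp.1]
    | of_succ i hi ih =>
      have hle : H i 0 ≤ H (i + 1) 0 := (hcell i hi 0 (by omega)).2.1.le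
      rw [ih] at hle
      exact le_antisymm hle (zero_le)
  have h0H : ∀ i, i ≤ n → H 0 i = 0 := by
    intro i hi
    induction hi using Nat.decreasingInduction with
    | self => rw [hnH 0 (Nat.zero_le n), hq.1]
    | of_succ i hi ih =>
      have hle : H 0 i ≤ H 0 (i + 1) := (hcell 0 (by omega) i hi).1.le
      rw [ih] at hle
      exact le_antisymm hle (zero_le)
  have hH0' : ∀ i, H i 0 = 0 := by
    intro i
    rcases le_total i n with h | h
    · exact hH0 i h
    · have : H i 0 = H n 0 := by simp only [H, Nat.sub_self, Nat.sub_eq_zero_of_le h]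
      rw [this, hH0 n le_rfl]
  have h0H' : ∀ i, H 0 i = 0 := by
    intro i
    rcases le_total i n with h | h
    · exact h0H i h
    · have : H 0 i = H 0 n := by simp only [H, Nat.sub_self, Nat.sub_eq_zero_of_le h]
      rw [this, h0H n le_rfl]
  have hcol : ∀ i : Fin n, ∃ j : Fin n, M i j := by
    intro i
    obtain ⟨j, hj, hM⟩ := grid_exists_mark (n := n) (fun q hq => hcell i i.2 q hq) hH0'
      (by rw [hnH _ i.2.le, hnH _ i.2]; exact (hq.2.1 i i.2).2)
    exact ⟨⟨j, hj⟩, hM⟩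
  choose σ hσ using hcol
  have hcu : ∀ i < n, ∀ j < n, ∀ j' < n, M i j → M i j' → j = j' := by
    intro i hi j hj j' hj' h h'
    rcases lt_trichotomy j j' with hlt | he | hlt
    · exact absurd h' (grid_mark_unique (fun q hq => hcell i hi q hq) hj' hlt h)
    · exact he
    · exact absurd h (grid_mark_unique (fun q hq => hcell i hi q hq) hj hlt h')
  have hinj : Function.Injective σ := by
    have key : ∀ i i' : Fin n, i < i' → σ i ≠ σ i' := by
      intro i i' hlt he
      have h1 := hσ i
      have h2 := hσ i'
      rw [he] at h1
      exact grid_mark_unique (M := fun i j => M j i) (G := fun i j => H j i) (n := n)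
        (i := σ i') (fun q hq => (hcell q hq _ (σ i').2).swap) i'.2 (Fin.lt_def.1 hlt) h1 h2
    intro i i' he
    rcases lt_trichotomy i i' with hlt | h | hlt
    · exact absurd he (key _ _ hlt)
    · exact h
    · exact absurd he.symm (key _ _ hlt)
  let π : Equiv.Perm (Fin n) := Equiv.ofBijective σ (Finite.injective_iff_bijective.1 hinj)
  have hMπ : ∀ i < n, ∀ j < n, (M i j ↔ permMark π i j) := by
    intro i hi j hj
    constructor
    · intro h
      exact ⟨hi, hcu i hi _ (π ⟨i, hi⟩).2 j hj (hσ ⟨i, hi⟩) h⟩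
    · rintro ⟨hi, rfl⟩
      exact hσ ⟨i, hi⟩
  have hcell' : ∀ i < n, ∀ j < n, CellAt (permMark π) H i j := by
    intro i hi j hj
    have := hcell i hi j hj
    rw [CellAt] at this ⊢
    rwa [propext (hMπ i hi j hj)] at this
  have hav : ¬ PattContains patt12345 π := by
    rw [pattContains_iff_incChain]
    rintro ⟨i, hi, j, hj, hM, hc⟩
    have h1 := (pos_iff_incChain hcell' h0H' hH0' i hi.le j hj.le 3).2 hc
    have h2 := ((hcell' i hi j hj).of_mark hM).2.2.1
    omega
  have hg := growth_cellAt permMark_right_unique permMark_left_unique (not_incChain_permMark hav)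
  have heq := grid_forward_unique (fun i _ j _ => hg i j) hcell'
    (fun j => (growth_zero_left _ j).trans (h0H' j).symm)
    (fun i => (growth_zero_right _ i).trans (hH0' i).symm)
  refine ⟨π, hav, fun j hj => ?_, fun i hi => ?_⟩
  · rw [heq n le_rfl j hj, hHn j hj]
  · rw [heq i hi n le_rfl, hnH i hi]

theorem ShapeChain.ext {n : ℕ} {l l' : Fin 4 → ℕ} {p p' : ℕ → Fin 4 → ℕ} (hp : ShapeChain n l p)
    (hp' : ShapeChain n l' p') (h : ∀ j ≤ n, p j = p' j) : p = p' := by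
  funext j
  rcases le_total j n with hj | hj
  · exact h j hj
  · rw [hp.2.2 j hj, hp'.2.2 j hj, ← hp.2.2 n le_rfl, ← hp'.2.2 n le_rfl, h n le_rfl]

theorem avoidCount_eq_card_chainPair (n : ℕ) :
    avoidCount patt12345 n = Nat.card (ChainPair n) := by
  have hg : ∀ π : {π : Equiv.Perm (Fin n) // ¬ PattContains patt12345 π},
      ∀ i j, CellAt (permMark π.1) (growth (permMark π.1)) i j := fun π =>
    growth_cellAt permMark_right_unique permMark_left_unique (not_incChain_permMark π.2)
  refine Nat.card_eq_of_bijective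
    (fun π => ⟨(fun j => growth (permMark π.1) n j, fun i => growth (permMark π.1) i n),
      growth (permMark π.1) n n, growth_shapeChain_left (hg π), growth_shapeChain_right (hg π)⟩)
    ⟨?_, ?_⟩
  · intro π π' h
    have h := Subtype.ext_iff.1 h
    have h1 := congrFun (congrArg Prod.fst h)
    have h2 := congrFun (congrArg Prod.snd h)
    have := (grid_backward_unique (hg π) (hg π') h1 h2).2
    refine Subtype.ext (Equiv.ext fun i => Fin.ext ?_)
    obtain ⟨_, h⟩ := (this i i.2 _ (π.1 i).2).1 ⟨i.2, rfl⟩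
    exact h.symm
  · rintro ⟨⟨p, q⟩, l, hp, hq⟩
    obtain ⟨π, hav, h1, h2⟩ := exists_perm_of_chainPair hp hq
    refine ⟨⟨π, hav⟩, Subtype.ext (Prod.ext ?_ ?_)⟩
    · exact (growth_shapeChain_left (hg ⟨π, hav⟩)).ext hp h1
    · exact (growth_shapeChain_right (hg ⟨π, hav⟩)).ext hq h2

open MvPolynomial in
/-- The `n`-th power of `X₀ + X₁ + X₂ + X₃` times the Vandermonde determinant. -/
noncomputable def walkPoly (n : ℕ) : MvPolynomial (Fin 4) ℤ :=
  (∑ i, X i) ^ n * (Matrix.vandermonde (X : Fin 4 → MvPolynomial (Fin 4) ℤ)).det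

/-- The coefficients of `walkPoly n`. -/
noncomputable def walkCoeff (n : ℕ) (x : Fin 4 → ℕ) : ℤ :=
  (walkPoly n).coeff (Finsupp.equivFunOnFinite.symm x)

theorem walkCoeff_succ (n : ℕ) (x : Fin 4 → ℕ) :
    walkCoeff (n + 1) x = ∑ c, if x c ≠ 0 then walkCoeff n (x - Pi.single c 1) else 0 := by
  have h : walkPoly (n + 1) = ∑ c, MvPolynomial.X c * walkPoly n := by
    rw [← Finset.sum_mul, walkPoly, walkPoly, pow_succ']
    ring
  rw [walkCoeff, h, MvPolynomial.coeff_sum]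
  refine Finset.sum_congr rfl fun c _ => ?_
  rw [MvPolynomial.coeff_X_mul', walkCoeff]
  simp only [Finsupp.mem_support_iff, Finsupp.equivFunOnFinite_symm_apply_apply]
  congr 2
  ext d
  simp [Finsupp.single_apply, Pi.single_apply, eq_comm]

theorem rename_walkPoly (n : ℕ) (σ : Equiv.Perm (Fin 4)) :
    MvPolynomial.rename σ (walkPoly n) = (Equiv.Perm.sign σ : ℤ) • walkPoly n := by
  rw [walkPoly, map_mul, map_pow, map_sum, AlgHom.map_det]
  have h1 : ∑ i, MvPolynomial.rename σ (MvPolynomial.X i : MvPolynomial (Fin 4) ℤ) =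
      ∑ i, MvPolynomial.X i := by
    simp only [MvPolynomial.rename_X]
    exact Equiv.sum_comp σ fun i => (MvPolynomial.X i : MvPolynomial (Fin 4) ℤ)
  have h2 : (MvPolynomial.rename (R := ℤ) σ).mapMatrix (Matrix.vandermonde MvPolynomial.X) =
      (Matrix.vandermonde MvPolynomial.X).submatrix σ id := by
    ext i j : 2
    simp [Matrix.vandermonde_apply]
  rw [h1, h2, Matrix.det_permute]
  simp only [zsmul_eq_mul]
  ring

theorem walkCoeff_comp_perm (n : ℕ) (σ : Equiv.Perm (Fin 4)) (x : Fin 4 → ℕ) :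
    walkCoeff n (x ∘ σ) = (Equiv.Perm.sign σ : ℤ) * walkCoeff n x := by
  have h := MvPolynomial.coeff_rename_mapDomain σ σ.injective (walkPoly n)
    (Finsupp.equivFunOnFinite.symm (x ∘ σ))
  have h2 : Finsupp.mapDomain σ (Finsupp.equivFunOnFinite.symm (x ∘ σ)) =
      Finsupp.equivFunOnFinite.symm x := by
    ext a
    rw [Finsupp.mapDomain_equiv_apply]
    simp
  rw [h2, rename_walkPoly, MvPolynomial.coeff_smul] at h
  rw [walkCoeff, ← h, walkCoeff, smul_eq_mul]

theorem walkCoeff_eq_zero (n : ℕ) {x : Fin 4 → ℕ} {i j : Fin 4} (hij : i ≠ j) (h : x i = x j) :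
    walkCoeff n x = 0 := by
  have h1 := walkCoeff_comp_perm n (Equiv.swap i j) x
  have h2 : x ∘ Equiv.swap i j = x := by
    ext k
    simp only [Function.comp_apply, Equiv.swap_apply_def]
    split_ifs <;> simp_all
  rw [h2, Equiv.Perm.sign_swap hij] at h1
  simp at h1
  omega

theorem antitone_fin_four {l : Fin 4 → ℕ} : Antitone l ↔ l 1 ≤ l 0 ∧ l 2 ≤ l 1 ∧ l 3 ≤ l 2 := by
  constructor
  · intro h
    exact ⟨h (by decide), h (by decide), h (by decide)⟩
  · rintro ⟨h1, h2, h3⟩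
    rw [Fin.antitone_iff_succ_le]
    intro i
    fin_cases i
    exacts [h1, h2, h3]

/-- The vector `(3, 2, 1, 0)`. -/
def staircase (i : Fin 4) : ℕ := 3 - i

theorem walkCoeff_zero {l : Fin 4 → ℕ} (hl : Antitone l) :
    walkCoeff 0 (l + staircase) = if l = 0 then 1 else 0 := by
  have hterm : ∀ σ : Equiv.Perm (Fin 4),
      (∏ i : Fin 4, (MvPolynomial.X (σ i) : MvPolynomial (Fin 4) ℤ) ^ (i : ℕ)).coeff
        (Finsupp.equivFunOnFinite.symm (l + staircase)) =
      if l = 0 ∧ σ = Fin.revPerm then 1 else 0 := by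
    intro σ
    simp only [MvPolynomial.X_pow_eq_monomial]
    rw [← MvPolynomial.monomial_sum_one, MvPolynomial.coeff_monomial]
    refine if_congr ?_ rfl rfl
    have hD : ∀ k, (∑ i : Fin 4, Finsupp.single (σ i) (i : ℕ)) k = (σ.symm k : ℕ) := by
      intro k
      rw [Finsupp.finsetSum_apply, Finset.sum_eq_single (σ.symm k)]
      · simp
      · intro b _ hb
        rw [Finsupp.single_apply, if_neg]
        rintro rfl
        simp at hb
      · simp
    constructor
    · intro h
      have h' : ∀ k, (σ.symm k : ℕ) = l k + staircase k := by
        intro k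
        rw [← hD, h]
        simp
      have h0 : l 0 = 0 := by
        have h1 := h' 0
        have h2 := (σ.symm 0).2
        simp only [staircase, Fin.val_zero] at h1
        omega
      have hl0 : l = 0 := by
        ext k
        have := hl (Fin.zero_le k)
        simp only [Pi.zero_apply]
        omega
      refine ⟨hl0, ?_⟩
      rw [← Equiv.symm_symm σ]
      have : σ.symm = Fin.revPerm := by
        ext k
        rw [h' k, hl0]
        fin_cases k <;> rfl
      rw [this]
      rfl
    · rintro ⟨rfl, rfl⟩
      ext k
      rw [hD]
      fin_cases k <;> rfl
  rw [walkCoeff, walkPoly, pow_zero, one_mul, Matrix.det_apply, MvPolynomial.coeff_sum]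
  simp only [Matrix.vandermonde_apply, Units.smul_def, MvPolynomial.coeff_smul, hterm]
  by_cases h : l = 0
  · simp only [h, true_and, if_true, smul_eq_mul, mul_ite, mul_one, mul_zero]
    rw [Finset.sum_ite_eq' Finset.univ (Fin.revPerm : Equiv.Perm (Fin 4)),
      if_pos (Finset.mem_univ _)]
    decide
  · simp [h]

/-- The number of standard fillings of the shape `l`, which has `n` boxes. -/
noncomputable def numChains (n : ℕ) (l : Fin 4 → ℕ) : ℕ := Nat.card {p // ShapeChain n l p}

theorem ShapeChain.antitone {n : ℕ} {l : Fin 4 → ℕ} {p : ℕ → Fin 4 → ℕ} (h : ShapeChain n l p) :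
    Antitone l := by
  have := (h.step 0).2.1
  rwa [Nat.sub_zero, h.2.2 n le_rfl] at this

theorem shapeChain_zero_iff {l : Fin 4 → ℕ} {p : ℕ → Fin 4 → ℕ} :
    ShapeChain 0 l p ↔ l = 0 ∧ p = 0 := by
  constructor
  · intro h
    have h0 : l = 0 := by rw [← h.2.2 0 le_rfl, h.1]
    exact ⟨h0, funext fun j => by rw [h.2.2 j (Nat.zero_le j), h0]; rfl⟩
  · rintro ⟨rfl, rfl⟩
    exact ⟨rfl, fun j hj => absurd hj (Nat.not_lt_zero j), fun _ _ => rfl⟩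

/-- Removing the last box of a standard filling. -/
noncomputable def shapeChainSuccEquiv (n : ℕ) {l : Fin 4 → ℕ} (hl : Antitone l) :
    {p // ShapeChain (n + 1) l p} ≃
      Σ c : Fin 4, {p // (Antitone (l - Pi.single c 1) ∧ 0 < l c) ∧
        ShapeChain n (l - Pi.single c 1) p} := by
  refine (Equiv.ofBijective (fun q => ⟨fun j => if j ≤ n then q.2.1 j else l, ?_⟩) ⟨?_, ?_⟩).symm
  rotate_left 2
  · obtain ⟨c, p, ⟨h1, h2⟩, hp⟩ := q
    have hs : Step (l - Pi.single c 1) l := by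
      refine ⟨h1, hl, Or.inr ⟨c, ?_⟩⟩
      ext k
      by_cases hk : k = c
      · subst hk; simp; omega
      · simp [hk]
    have hne : l - Pi.single c 1 ≠ l := by
      intro h
      have := congrFun h c
      simp at this
      omega
    refine ⟨by simp [hp.1], fun j hj => ?_, fun j hj => if_neg (by omega)⟩
    rcases Nat.lt_succ_iff_lt_or_eq.1 hj with hj | rfl
    · simpa only [if_pos hj.le, if_pos (show j + 1 ≤ n from hj)] using hp.2.1 j hj
    · simp only [le_refl, if_true, if_neg (Nat.not_succ_le_self j)]
      rw [hp.2.2 j le_rfl]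
      exact ⟨hs, hne⟩
  · rintro ⟨c, p, ⟨h1, h2⟩, hp⟩ ⟨c', p', ⟨h1', h2'⟩, hp'⟩ h
    have h := congrFun (Subtype.ext_iff.1 h)
    have hpp : p = p' := hp.ext hp' fun j hj => by
      have := h j
      simpa only [if_pos hj] using this
    subst hpp
    have hll : l - Pi.single c 1 = l - Pi.single c' 1 := by
      rw [← hp.2.2 n le_rfl, hp'.2.2 n le_rfl]
    obtain rfl : c = c' := by
      by_contra hcc
      have := congrFun hll c
      simp [hcc] at this
      omega
    rfl
  · rintro ⟨p, hp⟩
    obtain ⟨hs, hne⟩ := hp.2.1 n (Nat.lt_succ_self n)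
    rw [hp.2.2 (n + 1) le_rfl] at hs hne
    obtain ⟨ha, -, h | ⟨c, hc⟩⟩ := hs
    · exact absurd h hne
    have hpn : l - Pi.single c 1 = p n := by rw [hc, add_tsub_cancel_right]
    refine ⟨⟨c, fun j => if j ≤ n then p j else p n, ⟨?_, ?_⟩, ?_, ?_, ?_⟩, ?_⟩
    · rwa [hpn]
    · rw [hc]; simp
    · simp [hp.1]
    · intro j hj
      simpa only [if_pos hj.le, if_pos (show j + 1 ≤ n from hj)] using hp.2.1 j (by omega)
    · intro j hj
      rw [hpn]
      rcases hj.eq_or_lt with rfl | hj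
      · simp
      · exact if_neg (by omega)
    · refine Subtype.ext (funext fun j => ?_)
      by_cases hj : j ≤ n
      · simp only [if_pos hj]
      · simp only [if_neg hj]
        exact (hp.2.2 j (by omega)).symm

instance finite_shapeChain (n : ℕ) (l : Fin 4 → ℕ) : Finite {p // ShapeChain n l p} := by
  induction n generalizing l with
  | zero =>
    refine @Finite.of_subsingleton _ ⟨fun p q => Subtype.ext ?_⟩
    rw [(shapeChain_zero_iff.1 p.2).2, (shapeChain_zero_iff.1 q.2).2]
  | succ n ih =>
    by_cases hl : Antitone l
    · have : ∀ c : Fin 4, Finite {p // (Antitone (l - Pi.single c 1) ∧ 0 < l c) ∧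
          ShapeChain n (l - Pi.single c 1) p} := fun c =>
        Finite.of_injective (fun p => (⟨p.1, p.2.2⟩ : {p // ShapeChain n (l - Pi.single c 1) p}))
          fun p q h => Subtype.ext (congrArg Subtype.val h :)
      exact Finite.of_equiv _ (shapeChainSuccEquiv n hl).symm
    · exact @Finite.of_subsingleton _ ⟨fun p => absurd p.2.antitone hl⟩

open Classical in
theorem numChains_succ (n : ℕ) {l : Fin 4 → ℕ} (hl : Antitone l) :
    numChains (n + 1) l = ∑ c, if Antitone (l - Pi.single c 1) ∧ 0 < l c then
      numChains n (l - Pi.single c 1) else 0 := by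
  have : ∀ c : Fin 4, Finite {p // (Antitone (l - Pi.single c 1) ∧ 0 < l c) ∧
      ShapeChain n (l - Pi.single c 1) p} := fun c =>
    Finite.of_injective (fun p => (⟨p.1, p.2.2⟩ : {p // ShapeChain n (l - Pi.single c 1) p}))
      fun p q h => Subtype.ext (congrArg Subtype.val h :)
  rw [numChains, Nat.card_congr (shapeChainSuccEquiv n hl), Nat.card_sigma]
  refine Finset.sum_congr rfl fun c _ => ?_
  split_ifs with h
  · exact Nat.card_congr (Equiv.subtypeEquivRight fun p => and_iff_right h)
  · rw [Nat.card_eq_zero]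
    exact Or.inl ⟨fun p => h p.2.1⟩

theorem numChains_eq_walkCoeff (n : ℕ) {l : Fin 4 → ℕ} (hl : Antitone l) :
    (numChains n l : ℤ) = walkCoeff n (l + staircase) := by
  induction n generalizing l with
  | zero =>
    rw [walkCoeff_zero hl, numChains]
    split_ifs with h
    · rw [Nat.cast_eq_one, Nat.card_eq_one_iff_unique]
      refine ⟨⟨fun p q => Subtype.ext ?_⟩, ⟨⟨0, shapeChain_zero_iff.2 ⟨h, rfl⟩⟩⟩⟩
      rw [(shapeChain_zero_iff.1 p.2).2, (shapeChain_zero_iff.1 q.2).2]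
    · rw [Nat.cast_eq_zero, Nat.card_eq_zero]
      exact Or.inl ⟨fun p => h (shapeChain_zero_iff.1 p.2).1⟩
  | succ n ih =>
    rw [numChains_succ n hl, walkCoeff_succ, Nat.cast_sum]
    refine Finset.sum_congr rfl fun c _ => ?_
    split_ifs with h1 h2 h2
    · rw [ih h1.1]
      congr 1
      ext k
      by_cases hk : k = c
      · subst hk
        simp
        omega
      · simp [hk]
    · exact absurd h1.2 (by simp at h2; omega)
    · rw [Nat.cast_zero]
      symm
      rw [antitone_fin_four] at h1 hl
      fin_cases c <;> simp [staircase] at h1 h2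
      · exact walkCoeff_eq_zero n (i := 0) (j := 1) (by decide) (by simp [staircase]; omega)
      · exact walkCoeff_eq_zero n (i := 1) (j := 2) (by decide) (by simp [staircase]; omega)
      · exact walkCoeff_eq_zero n (i := 2) (j := 3) (by decide) (by simp [staircase]; omega)
      · omega
    · simp

theorem strictAnti_fin_four {x : Fin 4 → ℕ} : StrictAnti x ↔ x 1 < x 0 ∧ x 2 < x 1 ∧ x 3 < x 2 := by
  constructor
  · intro h
    exact ⟨h (by decide), h (by decide), h (by decide)⟩
  · rintro ⟨h1, h2, h3⟩
    rw [Fin.strictAnti_iff_succ_lt]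
    intro i
    fin_cases i
    exacts [h1, h2, h3]

theorem strictAnti_add_staircase {l : Fin 4 → ℕ} (hl : Antitone l) :
    StrictAnti (l + staircase) := by
  rw [antitone_fin_four] at hl
  rw [strictAnti_fin_four]
  simp [staircase]
  omega

theorem antitone_sub_staircase {x : Fin 4 → ℕ} (hx : StrictAnti x) :
    Antitone (x - staircase) ∧ x - staircase + staircase = x := by
  rw [strictAnti_fin_four] at hx
  rw [antitone_fin_four]
  constructor
  · simp [staircase]
    omega
  · ext k
    fin_cases k <;> simp [staircase] <;> omega

theorem walkCoeff_coe (n : ℕ) (d : Fin 4 →₀ ℕ) : walkCoeff n d = (walkPoly n).coeff d := by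
  rw [walkCoeff]
  congr 1
  ext
  simp

open Classical in
theorem avoidCount_eq_sum (n : ℕ) : (avoidCount patt12345 n : ℤ) =
    ∑ d ∈ (walkPoly n).support.filter (fun d : Fin 4 →₀ ℕ => StrictAnti ⇑d),
      (walkPoly n).coeff d ^ 2 := by
  set S := (walkPoly n).support.filter (fun d : Fin 4 →₀ ℕ => StrictAnti ⇑d) with hS
  have hcard : avoidCount patt12345 n = Nat.card (Σ d : S,
      {p // ShapeChain n ((d.1 : Fin 4 → ℕ) - staircase) p} ×
        {p // ShapeChain n ((d.1 : Fin 4 → ℕ) - staircase) p}) := by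
    rw [avoidCount_eq_card_chainPair]
    symm
    refine Nat.card_eq_of_bijective
      (fun s => ⟨(s.2.1.1, s.2.2.1), _, s.2.1.2, s.2.2.2⟩) ⟨?_, ?_⟩
    · rintro ⟨⟨d, hd⟩, ⟨p, hp⟩, ⟨q, hq⟩⟩ ⟨⟨d', hd'⟩, ⟨p', hp'⟩, ⟨q', hq'⟩⟩ h
      have h := Subtype.ext_iff.1 h
      obtain rfl : p = p' := congrArg Prod.fst h
      obtain rfl : q = q' := congrArg Prod.snd h
      have h1 : (d : Fin 4 → ℕ) - staircase = d' - staircase := by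
        rw [← hp.2.2 n le_rfl, ← hp'.2.2 n le_rfl]
      rw [hS, Finset.mem_filter] at hd hd'
      have h2 : (d : Fin 4 → ℕ) = d' := by
        rw [← (antitone_sub_staircase hd.2).2, h1, (antitone_sub_staircase hd'.2).2]
      obtain rfl : d = d' := DFunLike.coe_injective h2
      rfl
    · rintro ⟨⟨p, q⟩, l, hp, hq⟩
      have hl := hp.antitone
      have hd := strictAnti_add_staircase hl
      have hsub : (Finsupp.equivFunOnFinite.symm (l + staircase) : Fin 4 → ℕ) - staircase = l := by
        ext k
        simp
      refine ⟨⟨⟨Finsupp.equivFunOnFinite.symm (l + staircase), ?_⟩, ⟨p, ?_⟩, ⟨q, ?_⟩⟩, rfl⟩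
      · rw [hS, Finset.mem_filter]
        refine ⟨?_, hd⟩
        rw [MvPolynomial.mem_support_iff]
        change walkCoeff n (l + staircase) ≠ 0
        rw [← numChains_eq_walkCoeff n hl, Nat.cast_ne_zero, numChains, Nat.card_ne_zero]
        exact ⟨⟨⟨p, hp⟩⟩, finite_shapeChain n l⟩
      · rw [hsub]
        exact hp
      · rw [hsub]
        exact hq
  rw [hcard, Nat.card_sigma, Nat.cast_sum, Finset.sum_coe_sort S (fun d =>
    ((Nat.card ({p // ShapeChain n ((d : Fin 4 → ℕ) - staircase) p} ×
        {p // ShapeChain n ((d : Fin 4 → ℕ) - staircase) p}) : ℕ) : ℤ))]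
  refine Finset.sum_congr rfl fun d hd => ?_
  rw [hS, Finset.mem_filter] at hd
  obtain ⟨h1, h2⟩ := antitone_sub_staircase hd.2
  rw [Nat.card_prod, Nat.cast_mul]
  have := numChains_eq_walkCoeff n h1
  rw [h2, walkCoeff_coe, numChains] at this
  rw [this, sq]

open Classical in
theorem sum_strictAnti_perm {x : Fin 4 → ℕ} (hx : Function.Injective x) :
    ∑ σ : Equiv.Perm (Fin 4), (if StrictAnti (x ∘ σ) then 1 else 0 : ℤ) = 1 := by
  have hex : ∃ τ : Equiv.Perm (Fin 4), StrictAnti (x ∘ τ) := by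
    refine ⟨Fin.revPerm.trans (Tuple.sort x), ?_⟩
    have h : StrictMono (x ∘ Tuple.sort x) :=
      (Tuple.monotone_sort x).strictMono_of_injective (hx.comp (Tuple.sort x).injective)
    intro i j hij
    exact h (Fin.rev_lt_rev.2 hij)
  obtain ⟨τ, hτ⟩ := hex
  rw [Finset.sum_eq_single τ, if_pos hτ]
  · intro σ _ hσ
    refine if_neg fun h => hσ ?_
    have := Tuple.unique_antitone h.antitone hτ.antitone
    exact Equiv.ext fun i => hx (congrFun this i)
  · simp

open Classical in
theorem sum_sq_coeff_walkPoly (n : ℕ) :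
    ∑ d ∈ (walkPoly n).support, (walkPoly n).coeff d ^ 2 =
      24 * (avoidCount patt12345 n : ℤ) := by
  have hinj : ∀ d ∈ (walkPoly n).support, Function.Injective (d : Fin 4 → ℕ) := by
    intro d hd i j hij
    by_contra hne
    rw [MvPolynomial.mem_support_iff, ← walkCoeff_coe] at hd
    exact hd (walkCoeff_eq_zero n hne hij)
  have hcoeff : ∀ (σ : Equiv.Perm (Fin 4)) (d : Fin 4 →₀ ℕ),
      (walkPoly n).coeff (Finsupp.equivFunOnFinite.symm (d ∘ σ)) ^ 2 =
        (walkPoly n).coeff d ^ 2 := by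
    intro σ d
    have h : walkCoeff n (d ∘ σ) ^ 2 = walkCoeff n d ^ 2 := by
      rw [walkCoeff_comp_perm, mul_pow]
      have : ((Equiv.Perm.sign σ : ℤ)) ^ 2 = 1 := by
        rcases Int.units_eq_one_or (Equiv.Perm.sign σ) with h | h <;> simp [h]
      rw [this, one_mul]
    rwa [walkCoeff_coe, walkCoeff] at h
  have hσ : ∀ σ : Equiv.Perm (Fin 4), ∑ d ∈ (walkPoly n).support,
      (if StrictAnti ((d : Fin 4 → ℕ) ∘ σ) then 1 else 0 : ℤ) * (walkPoly n).coeff d ^ 2 =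
        avoidCount patt12345 n := by
    intro σ
    rw [avoidCount_eq_sum, Finset.sum_filter]
    simp only [ite_mul, one_mul, zero_mul]
    refine Finset.sum_bij' (fun d _ => Finsupp.equivFunOnFinite.symm (d ∘ σ))
      (fun d _ => Finsupp.equivFunOnFinite.symm (d ∘ σ.symm)) ?_ ?_ ?_ ?_ ?_
    · intro d hd
      rw [MvPolynomial.mem_support_iff] at hd ⊢
      rwa [← sq_eq_zero_iff.ne, hcoeff, sq_eq_zero_iff.ne]
    · intro d hd
      rw [MvPolynomial.mem_support_iff] at hd ⊢
      rwa [← sq_eq_zero_iff.ne, hcoeff, sq_eq_zero_iff.ne]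
    · intro d _
      ext k
      simp
    · intro d _
      ext k
      simp
    · intro d _
      rw [hcoeff]
      simp only [Finsupp.coe_equivFunOnFinite_symm]
      exact if_congr Iff.rfl rfl rfl
  calc ∑ d ∈ (walkPoly n).support, (walkPoly n).coeff d ^ 2
      = ∑ d ∈ (walkPoly n).support, ∑ σ : Equiv.Perm (Fin 4),
        (if StrictAnti ((d : Fin 4 → ℕ) ∘ σ) then 1 else 0 : ℤ) * (walkPoly n).coeff d ^ 2 := by
        refine Finset.sum_congr rfl fun d hd => ?_
        rw [← Finset.sum_mul, sum_strictAnti_perm (hinj d hd), one_mul]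
    _ = 24 * (avoidCount patt12345 n : ℤ) := by
        rw [Finset.sum_comm, Finset.sum_congr rfl fun σ _ => hσ σ, Finset.sum_const,
          Finset.card_univ, Fintype.card_perm, Fintype.card_fin]
        simp [Nat.factorial]

open MeasureTheory in
theorem integral_exp_int_mul (k : ℤ) :
    ∫ x in Set.Ioc (-Real.pi) Real.pi, Complex.exp (k * x * Complex.I) =
      if k = 0 then (2 * Real.pi : ℂ) else 0 := by
  rw [← intervalIntegral.integral_of_le (by linarith [Real.pi_pos])]
  split_ifs with hk
  · subst hk
    simp
    ring
  · have hc : (k * Complex.I : ℂ) ≠ 0 := mul_ne_zero (Int.cast_ne_zero.2 hk) Complex.I_ne_zero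
    have h := integral_exp_mul_complex (a := -Real.pi) (b := Real.pi) hc
    have h2 : Complex.exp (k * Complex.I * (Real.pi : ℝ)) =
        Complex.exp (k * Complex.I * ((-Real.pi : ℝ) : ℂ)) := by
      rw [Complex.exp_eq_exp_iff_exists_int]
      refine ⟨k, ?_⟩
      push_cast
      ring
    rw [h2, sub_self, zero_div] at h
    rw [← h]
    congr 1
    ext x
    ring_nf

/-- The point of the unit torus with angles `t`. -/
noncomputable def torusPoint (t : Fin 4 → ℝ) (i : Fin 4) : ℂ := Complex.exp (t i * Complex.I)

/-- The cube `(-π, π]³`. -/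
def angleBox : Set (Fin 3 → ℝ) := Set.univ.pi fun _ => Set.Ioc (-Real.pi) Real.pi

theorem aeval_walkPoly (n : ℕ) (z : Fin 4 → ℂ) :
    MvPolynomial.aeval z (walkPoly n) =
      (∑ i, z i) ^ n * ∏ i, ∏ j ∈ Finset.Ioi i, (z j - z i) := by
  rw [walkPoly, map_mul, map_pow, map_sum, AlgHom.map_det]
  have h : (MvPolynomial.aeval (R := ℤ) z).mapMatrix (Matrix.vandermonde MvPolynomial.X) =
      Matrix.vandermonde z := by
    ext i j
    simp [Matrix.vandermonde_apply]
  rw [h, Matrix.det_vandermonde]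
  simp

theorem isHomogeneous_walkPoly (n : ℕ) : (walkPoly n).IsHomogeneous (n + 6) := by
  have h1 : ((∑ i, MvPolynomial.X i : MvPolynomial (Fin 4) ℤ) ^ n).IsHomogeneous n := by
    simpa using (MvPolynomial.IsHomogeneous.sum Finset.univ (MvPolynomial.X (R := ℤ)) 1
      fun i _ => MvPolynomial.isHomogeneous_X ℤ i).pow n
  refine h1.mul ?_
  rw [Matrix.det_vandermonde]
  have h2 : ∀ i : Fin 4, (∏ j ∈ Finset.Ioi i,
      (MvPolynomial.X j - MvPolynomial.X i : MvPolynomial (Fin 4) ℤ)).IsHomogeneous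
        (∑ j ∈ Finset.Ioi i, 1) := fun i =>
    MvPolynomial.IsHomogeneous.prod _ _ _ fun j _ =>
      (MvPolynomial.isHomogeneous_X ℤ j).sub (MvPolynomial.isHomogeneous_X ℤ i)
  exact MvPolynomial.IsHomogeneous.prod Finset.univ _ _ fun i _ => h2 i

theorem aeval_torusPoint (n : ℕ) (s : Fin 3 → ℝ) :
    MvPolynomial.aeval (torusPoint (Fin.cons 0 s)) (walkPoly n) =
      ∑ d ∈ (walkPoly n).support, (((walkPoly n).coeff d : ℤ) : ℂ) *
        ∏ k, Complex.exp ((d k.succ : ℕ) * s k * Complex.I) := by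
  rw [MvPolynomial.aeval_def, MvPolynomial.eval₂_eq']
  refine Finset.sum_congr rfl fun d _ => ?_
  rw [Fin.prod_univ_succ]
  simp only [torusPoint, Fin.cons_zero, Fin.cons_succ, ← Complex.exp_nat_mul]
  simp [mul_assoc]

open MeasureTheory in
theorem integral_angleBox_prod_exp (c : Fin 3 → ℤ) :
    ∫ s in angleBox, ∏ k, Complex.exp (c k * s k * Complex.I) =
      if c = 0 then (2 * Real.pi : ℂ) ^ 3 else 0 := by
  rw [angleBox, volume_pi, Measure.restrict_pi_pi,
    integral_fintype_prod_eq_prod (f := fun k (x : ℝ) => Complex.exp (c k * x * Complex.I))]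
  simp only [integral_exp_int_mul]
  split_ifs with h
  · simp [h]
  · obtain ⟨k, hk⟩ := Function.ne_iff.1 h
    exact Finset.prod_eq_zero (Finset.mem_univ k) (if_neg hk)

open MeasureTheory in
theorem integral_normSq_walkPoly (n : ℕ) :
    ∫ s in angleBox, ‖MvPolynomial.aeval (torusPoint (Fin.cons 0 s)) (walkPoly n)‖ ^ 2 =
      (2 * Real.pi) ^ 3 * 24 * avoidCount patt12345 n := by
  have hinj : ∀ d ∈ (walkPoly n).support, ∀ e ∈ (walkPoly n).support,
      ((fun k : Fin 3 => ((d k.succ : ℤ) - e k.succ)) = 0 ↔ e = d) := by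
    intro d hd e he
    rw [MvPolynomial.mem_support_iff] at hd he
    constructor
    · intro h
      have hd' := isHomogeneous_walkPoly n hd
      have he' := isHomogeneous_walkPoly n he
      have h3 : ∀ k : Fin 3, d k.succ = e k.succ := fun k => by
        have := congrFun h k
        simp only [Pi.zero_apply] at this
        omega
      rw [Finsupp.weight_apply, Finsupp.sum_fintype _ _ (by simp), Fin.sum_univ_succ] at hd' he'
      simp only [Pi.one_apply, smul_eq_mul, mul_one, h3] at hd' he'
      ext k
      refine Fin.cases ?_ (fun k => (h3 k).symm) k
      omega
    · rintro rfl
      ext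
      simp
  have hpt : ∀ s : Fin 3 → ℝ,
      ((‖MvPolynomial.aeval (torusPoint (Fin.cons 0 s)) (walkPoly n)‖ ^ 2 : ℝ) : ℂ) =
      ∑ d ∈ (walkPoly n).support, ∑ e ∈ (walkPoly n).support,
        (((walkPoly n).coeff d : ℤ) : ℂ) * ((walkPoly n).coeff e : ℤ) *
          ∏ k, Complex.exp ((((d k.succ : ℤ) - e k.succ : ℤ) : ℂ) * s k * Complex.I) := by
    intro s
    rw [Complex.ofReal_pow, ← Complex.mul_conj', aeval_torusPoint, map_sum, Finset.sum_mul_sum]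
    refine Finset.sum_congr rfl fun d _ => Finset.sum_congr rfl fun e _ => ?_
    rw [map_mul, map_prod, mul_mul_mul_comm, ← Finset.prod_mul_distrib]
    congr 1
    · simp
    · refine Finset.prod_congr rfl fun k _ => ?_
      rw [← Complex.exp_conj, ← Complex.exp_add]
      congr 1
      simp
      ring
  have hcont : ∀ d e : Fin 4 →₀ ℕ, Integrable (fun s : Fin 3 → ℝ =>
      (((walkPoly n).coeff d : ℤ) : ℂ) * ((walkPoly n).coeff e : ℤ) *
          ∏ k, Complex.exp ((((d k.succ : ℤ) - e k.succ : ℤ) : ℂ) * s k * Complex.I))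
        (volume.restrict angleBox) := by
    intro d e
    have hK : IsCompact (Set.univ.pi fun _ : Fin 3 => Set.Icc (-Real.pi) Real.pi) :=
      isCompact_univ_pi fun _ => isCompact_Icc
    refine IntegrableOn.mono_set (Continuous.continuousOn ?_ |>.integrableOn_compact hK)
      (Set.pi_mono fun _ _ => Set.Ioc_subset_Icc_self)
    fun_prop
  rw [← Complex.ofReal_inj, ← integral_complex_ofReal]
  simp only [hpt]
  rw [integral_finsetSum _ fun d _ => integrable_finsetSum _ fun e _ => hcont d e]
  have hsum := sum_sq_coeff_walkPoly n
  have hsum' : ∑ d ∈ (walkPoly n).support, (((walkPoly n).coeff d : ℤ) : ℂ) ^ 2 =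
      24 * avoidCount patt12345 n := by exact_mod_cast hsum
  have hcast : (((2 * Real.pi) ^ 3 * 24 * avoidCount patt12345 n : ℝ) : ℂ) =
      (2 * Real.pi) ^ 3 * (24 * avoidCount patt12345 n) := by
    push_cast
    ring
  rw [hcast, ← hsum', Finset.mul_sum]
  refine Finset.sum_congr rfl fun d hd => ?_
  rw [integral_finsetSum _ fun e _ => hcont d e, Finset.sum_eq_single d]
  · rw [integral_const_mul]
    have := integral_angleBox_prod_exp (fun k : Fin 3 => ((d k.succ : ℤ) - d k.succ))
    rw [this, if_pos (by ext; simp)]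
    ring
  · intro e he hne
    rw [integral_const_mul]
    have := integral_angleBox_prod_exp (fun k : Fin 3 => ((d k.succ : ℤ) - e k.succ))
    rw [this, if_neg (by rwa [hinj d hd e he]), mul_zero]
  · exact fun h => absurd hd h

/-- `chord x` is, up to sign, the length of a chord of the unit circle subtending the angle `x`. -/
noncomputable def chord (x : ℝ) : ℝ := x * Real.sinc (x / 2)

theorem sq_chord (x : ℝ) : chord x ^ 2 = 2 * (1 - Real.cos x) := by
  rcases eq_or_ne x 0 with rfl | hx
  · simp [chord]
  · rw [chord, Real.sinc_of_ne_zero (by simpa using hx)]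
    have h1 : Real.cos x = Real.cos (2 * (x / 2)) := by ring_nf
    have h2 := Real.sin_sq_add_cos_sq (x / 2)
    have h3 : x * (Real.sin (x / 2) / (x / 2)) = 2 * Real.sin (x / 2) := by field_simp
    rw [h3, h1, Real.cos_two_mul]
    linarith

theorem sq_chord_le (x : ℝ) : chord x ^ 2 ≤ x ^ 2 := by
  rw [sq_chord]
  linarith [Real.one_sub_sq_div_two_le_cos (x := x)]

theorem le_sq_chord {x : ℝ} (hx : |x| ≤ Real.pi) : 4 / Real.pi ^ 2 * x ^ 2 ≤ chord x ^ 2 := by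
  rw [sq_chord]
  have := Real.cos_le_one_sub_mul_cos_sq hx
  linear_combination 2 * this

theorem continuous_chord : Continuous chord :=
  continuous_id.mul (Real.continuous_sinc.comp (continuous_id.div_const 2))

theorem tendsto_inv_mul_chord {R : ℕ → ℝ} (hR0 : ∀ᶠ n in atTop, R n ≠ 0)
    (hR : Tendsto R atTop (nhds 0)) (x : ℝ) :
    Tendsto (fun n => (R n)⁻¹ * chord (R n * x)) atTop (nhds x) := by
  have h : Tendsto (fun n => x * Real.sinc (R n * x / 2)) atTop
      (nhds (x * Real.sinc (0 * x / 2))) :=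
    (Real.continuous_sinc.continuousAt.tendsto.comp
      ((hR.mul_const x).div_const 2)).const_mul x
  simp only [zero_mul, zero_div, Real.sinc_zero, mul_one] at h
  refine h.congr' ?_
  filter_upwards [hR0] with n hn
  rw [chord]
  field_simp

theorem norm_torusPoint_sub (t : Fin 4 → ℝ) (i j : Fin 4) :
    ‖torusPoint t j - torusPoint t i‖ ^ 2 = chord (t j - t i) ^ 2 := by
  rw [sq_chord, Complex.sq_norm, Complex.normSq_apply, torusPoint, torusPoint, Real.cos_sub]
  simp only [Complex.sub_re, Complex.sub_im, Complex.exp_ofReal_mul_I_re,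
    Complex.exp_ofReal_mul_I_im]
  have h1 := Real.sin_sq_add_cos_sq (t i)
  have h2 := Real.sin_sq_add_cos_sq (t j)
  linear_combination h1 + h2

theorem norm_sum_torusPoint (t : Fin 4 → ℝ) :
    ‖∑ i, torusPoint t i‖ ^ 2 = 16 * (1 - 1 / 32 * ∑ i, ∑ j, chord (t i - t j) ^ 2) := by
  have h1 : ‖∑ i, torusPoint t i‖ ^ 2 = ∑ i, ∑ j, Real.cos (t i - t j) := by
    rw [Complex.sq_norm, Complex.normSq_apply, Complex.re_sum, Complex.im_sum,
      Finset.sum_mul_sum, Finset.sum_mul_sum, ← Finset.sum_add_distrib]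
    refine Finset.sum_congr rfl fun i _ => ?_
    rw [← Finset.sum_add_distrib]
    refine Finset.sum_congr rfl fun j _ => ?_
    simp only [torusPoint, Complex.exp_ofReal_mul_I_re, Complex.exp_ofReal_mul_I_im, Real.cos_sub]
  rw [h1]
  simp only [sq_chord, ← Finset.mul_sum, Finset.sum_sub_distrib, Finset.sum_const,
    Finset.card_univ, Fintype.card_fin]
  simp
  ring

/-- The squared modulus of `walkPoly n` on the torus, divided by `16 ^ n`. -/
noncomputable def torusDensity (n : ℕ) (t : Fin 4 → ℝ) : ℝ :=
  (1 - 1 / 32 * ∑ i, ∑ j, chord (t i - t j) ^ 2) ^ n *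
    ∏ i, ∏ j ∈ Finset.Ioi i, chord (t j - t i) ^ 2

theorem norm_aeval_torusPoint (n : ℕ) (t : Fin 4 → ℝ) :
    ‖MvPolynomial.aeval (torusPoint t) (walkPoly n)‖ ^ 2 = 16 ^ n * torusDensity n t := by
  rw [aeval_walkPoly, norm_mul, norm_pow, mul_pow, ← pow_mul, mul_comm n, pow_mul,
    norm_sum_torusPoint, mul_pow, torusDensity, mul_assoc]
  simp only [norm_prod, ← Finset.prod_pow, norm_torusPoint_sub]

theorem continuous_torusDensity (n : ℕ) : Continuous (torusDensity n) := by
  have := continuous_chord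
  unfold torusDensity
  fun_prop

open MeasureTheory in
theorem integral_torusDensity (n : ℕ) :
    16 ^ n * ∫ s in angleBox, torusDensity n (Fin.cons 0 s) =
      (2 * Real.pi) ^ 3 * 24 * avoidCount patt12345 n := by
  rw [← integral_normSq_walkPoly, ← integral_const_mul]
  simp only [norm_aeval_torusPoint]

/-- The limit of `torusDensity` under Brownian scaling. -/
noncomputable def gaussDensity (t : Fin 4 → ℝ) : ℝ :=
  Real.exp (-(1 / 32 * ∑ i, ∑ j, (t i - t j) ^ 2)) * ∏ i, ∏ j ∈ Finset.Ioi i, (t j - t i) ^ 2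

theorem inv_pow_mul_torusDensity {R : ℝ} (n : ℕ) (t : Fin 4 → ℝ) :
    R⁻¹ ^ 12 * torusDensity n (R • t) =
      (1 - 1 / 32 * ∑ i, ∑ j, chord (R * (t i - t j)) ^ 2) ^ n *
        ∏ i, ∏ j ∈ Finset.Ioi i, (R⁻¹ * chord (R * (t j - t i))) ^ 2 := by
  have hexp : R⁻¹ ^ 12 = ∏ i : Fin 4, ∏ j ∈ Finset.Ioi i, R⁻¹ ^ 2 := by
    simp only [Finset.prod_const, Fin.card_Ioi, Fin.prod_univ_four]
    simp
    ring
  rw [torusDensity, mul_left_comm, hexp, ← Finset.prod_mul_distrib]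
  simp only [← Finset.prod_mul_distrib, ← mul_pow, Pi.smul_apply, smul_eq_mul, ← mul_sub]

theorem tendsto_torusDensity {R : ℕ → ℝ} (hR0 : ∀ᶠ n in atTop, R n ≠ 0)
    (hR : Tendsto R atTop (nhds 0)) (hRn : ∀ᶠ n : ℕ in atTop, n * R n ^ 2 = 1) (t : Fin 4 → ℝ) :
    Tendsto (fun n => (R n)⁻¹ ^ 12 * torusDensity n (R n • t)) atTop (nhds (gaussDensity t)) := by
  simp only [inv_pow_mul_torusDensity]
  refine Tendsto.mul ?_ (tendsto_finsetProd _ fun i _ => tendsto_finsetProd _ fun j _ =>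
    (tendsto_inv_mul_chord hR0 hR _).pow 2)
  simp only [sub_eq_add_neg (1 : ℝ)]
  refine Real.tendsto_one_add_pow_exp_of_tendsto ?_
  have h : Tendsto (fun n => -(1 / 32 * ∑ i, ∑ j, ((R n)⁻¹ * chord (R n * (t i - t j))) ^ 2)) atTop
      (nhds (-(1 / 32 * ∑ i, ∑ j, (t i - t j) ^ 2))) :=
    ((tendsto_finsetSum _ fun i _ => tendsto_finsetSum _ fun j _ =>
      (tendsto_inv_mul_chord hR0 hR _).pow 2).const_mul _).neg
  refine h.congr' ?_
  filter_upwards [hR0, hRn] with n h0 hn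
  have hinv : (R n)⁻¹ ^ 2 = n := by
    field_simp
    linarith
  simp only [mul_pow, hinv, ← Finset.mul_sum]
  ring

theorem abs_torusDensity_le {R : ℝ} {n : ℕ} (hn : n * R ^ 2 = 1) {s : Fin 3 → ℝ}
    (hs : R • s ∈ angleBox) :
    |R⁻¹ ^ 12 * torusDensity n (R • Fin.cons 0 s)| ≤
      Real.exp (-(1 / (4 * Real.pi ^ 2)) * ∑ k, s k ^ 2) *
        ∏ i, ∏ j ∈ Finset.Ioi i,
          ((Fin.cons 0 s : Fin 4 → ℝ) j - (Fin.cons 0 s : Fin 4 → ℝ) i) ^ 2 := by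
  have hR : R ≠ 0 := by
    rintro rfl
    simp at hn
  set t : Fin 4 → ℝ := Fin.cons 0 s with ht
  have hbase : 0 ≤ 1 - 1 / 32 * ∑ i, ∑ j, chord (R * (t i - t j)) ^ 2 := by
    have := norm_sum_torusPoint (R • t)
    simp only [Pi.smul_apply, smul_eq_mul, ← mul_sub] at this
    nlinarith [sq_nonneg ‖∑ i, torusPoint (R • t) i‖]
  rw [inv_pow_mul_torusDensity, abs_of_nonneg (mul_nonneg (pow_nonneg hbase n)
    (Finset.prod_nonneg fun i _ => Finset.prod_nonneg fun j _ => sq_nonneg _))]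
  refine mul_le_mul ?_ ?_ (Finset.prod_nonneg fun i _ => Finset.prod_nonneg fun j _ => sq_nonneg _)
    (Real.exp_nonneg _)
  · have hk : ∀ k, 4 / Real.pi ^ 2 * (R * s k) ^ 2 ≤ chord (R * s k) ^ 2 := by
      intro k
      have := hs k (Set.mem_univ k)
      simp only [Pi.smul_apply, smul_eq_mul, Set.mem_Ioc] at this
      exact le_sq_chord (abs_le.2 ⟨this.1.le, this.2⟩)
    have hsum : 2 * ∑ k, chord (R * s k) ^ 2 ≤ ∑ i, ∑ j, chord (R * (t i - t j)) ^ 2 := by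
      have heven : ∀ x, chord (-x) ^ 2 = chord x ^ 2 := fun x => by simp [sq_chord]
      have hsplit : ∀ f : Fin 4 → Fin 4 → ℝ, ∑ i, ∑ j, f i j =
          f 0 0 + ∑ l, f 0 (Fin.succ l) +
            ∑ k, (f (Fin.succ k) 0 + ∑ l, f (Fin.succ k) (Fin.succ l)) := by
        intro f
        rw [Fin.sum_univ_succ, Fin.sum_univ_succ (f 0)]
        congr 1
      rw [hsplit fun i j => chord (R * (t i - t j)) ^ 2]
      simp only [ht, Fin.cons_zero, Fin.cons_succ, zero_sub, sub_zero, mul_neg, heven,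
        Finset.sum_add_distrib]
      have : 0 ≤ ∑ i, ∑ j, chord (R * (s i - s j)) ^ 2 :=
        Finset.sum_nonneg fun i _ => Finset.sum_nonneg fun j _ => sq_nonneg _
      have := sq_nonneg (chord (R * 0))
      linarith
    have hsum2 : 4 / Real.pi ^ 2 * R ^ 2 * ∑ k, s k ^ 2 ≤ ∑ k, chord (R * s k) ^ 2 := by
      rw [Finset.mul_sum]
      refine Finset.sum_le_sum fun k _ => ?_
      rw [mul_assoc, ← mul_pow]
      exact hk k
    calc _ ≤ Real.exp (-(1 / 16 * (4 / Real.pi ^ 2 * R ^ 2 * ∑ k, s k ^ 2))) ^ n := by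
          refine pow_le_pow_left₀ hbase ?_ n
          refine le_trans ?_ (Real.add_one_le_exp _)
          linarith
      _ = _ := by
          rw [← Real.exp_nat_mul]
          congr 1
          linear_combination (-(1 / (4 * Real.pi ^ 2)) * ∑ k, s k ^ 2) * hn
  · refine Finset.prod_le_prod (fun i _ => Finset.prod_nonneg fun j _ => sq_nonneg _) fun i _ =>
      Finset.prod_le_prod (fun j _ => sq_nonneg _) fun j _ => ?_
    rw [mul_pow]
    have := sq_chord_le (R * (t j - t i))
    have hR2 : 0 < R ^ 2 := by positivity
    rw [inv_pow, inv_mul_le_iff₀ hR2, ← mul_pow]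
    exact this

open MeasureTheory in
theorem integrable_pow_mul_gaussian {b : ℝ} (hb : 0 < b) (k : ℕ) :
    Integrable fun x : ℝ => x ^ k * Real.exp (-b * x ^ 2) := by
  have := integrable_rpow_mul_exp_neg_mul_sq hb (s := k) (by linarith [k.cast_nonneg (α := ℝ)])
  simpa only [Real.rpow_natCast] using this

open MeasureTheory in
theorem integrable_prod_gaussian {m : ℕ} {b : ℝ} (hb : 0 < b) :
    Integrable fun t : Fin m → ℝ =>
      Real.exp (-b * ∑ k, t k ^ 2) * (∏ k, (1 + t k ^ 2)) ^ 6 := by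
  have h : Integrable fun x : ℝ => (x ^ 2 + 1) ^ 6 * Real.exp (-b * x ^ 2) := by
    simp only [add_pow, one_pow, mul_one, ← pow_mul, Finset.sum_mul]
    refine integrable_finsetSum _ fun k _ => ?_
    have := (integrable_pow_mul_gaussian hb (2 * k)).const_mul (Nat.choose 6 k : ℝ)
    refine this.congr (Eventually.of_forall fun x => ?_)
    ring
  have h2 := Integrable.fintype_prod (ι := Fin m) (μ := fun _ => volume) fun _ => h
  refine h2.congr (Eventually.of_forall fun t => ?_)
  simp only [Finset.prod_mul_distrib, Finset.prod_pow, ← Real.exp_sum, Finset.mul_sum,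
    add_comm (1 : ℝ)]
  ring

theorem prod_sq_sub_le (t : Fin 4 → ℝ) :
    ∏ i, ∏ j ∈ Finset.Ioi i, (t j - t i) ^ 2 ≤ 4 ^ 6 * (∏ k, (1 + t k ^ 2)) ^ 6 := by
  have h2 : ∀ k, t k ^ 2 ≤ ∏ k, (1 + t k ^ 2) := fun k => by
    have := Finset.prod_le_prod_of_subset_of_one_le (f := fun k => 1 + t k ^ 2)
      (Finset.subset_univ {k}) (fun k _ => by positivity)
      fun k _ _ => by nlinarith [sq_nonneg (t k)]
    rw [Finset.prod_singleton] at this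
    linarith
  have h3 : ∀ i j, (t j - t i) ^ 2 ≤ 4 * ∏ k, (1 + t k ^ 2) := fun i j => by
    nlinarith [h2 i, h2 j, sq_nonneg (t i + t j)]
  calc _ ≤ ∏ i : Fin 4, ∏ j ∈ Finset.Ioi i, 4 * ∏ k, (1 + t k ^ 2) :=
        Finset.prod_le_prod (fun i _ => Finset.prod_nonneg fun j _ => sq_nonneg _) fun i _ =>
          Finset.prod_le_prod (fun j _ => sq_nonneg _) fun j _ => h3 i j
    _ = _ := by
        rw [← mul_pow]
        simp only [Finset.prod_const, Fin.card_Ioi]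
        rw [Fin.prod_univ_four, ← pow_add, ← pow_add, ← pow_add]
        rfl

open MeasureTheory in
theorem tendsto_avoidCount :
    Tendsto (fun n : ℕ => (2 * Real.pi) ^ 3 * 24 * avoidCount patt12345 n * √n ^ 15 / 16 ^ n) atTop
      (nhds (∫ s : Fin 3 → ℝ, gaussDensity (Fin.cons 0 s))) := by
  set R : ℕ → ℝ := fun n => (√n)⁻¹ with hRdef
  have hR0 : ∀ᶠ n in atTop, R n ≠ 0 := by
    filter_upwards [eventually_gt_atTop 0] with n hn
    simp [hRdef, hn.ne']
  have hR : Tendsto R atTop (nhds 0) :=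
    (Real.tendsto_sqrt_atTop.comp tendsto_natCast_atTop_atTop).inv_tendsto_atTop
  have hRn : ∀ᶠ n : ℕ in atTop, n * R n ^ 2 = 1 := by
    filter_upwards [eventually_gt_atTop 0] with n hn
    have : (n : ℝ) ≠ 0 := by exact_mod_cast hn.ne'
    simp [hRdef, inv_pow, this]
  have hbox : MeasurableSet angleBox := MeasurableSet.univ_pi fun _ => measurableSet_Ioc
  have hcons : Continuous fun s : Fin 3 → ℝ => (Fin.cons 0 s : Fin 4 → ℝ) := by fun_prop
  have hsmul : ∀ (r : ℝ) (s : Fin 3 → ℝ),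
      (Fin.cons 0 (r • s) : Fin 4 → ℝ) = r • (Fin.cons 0 s : Fin 4 → ℝ) := by
    intro r s
    ext k
    refine Fin.cases ?_ (fun k => ?_) k <;> simp
  set g : ℕ → (Fin 3 → ℝ) → ℝ := fun n =>
    angleBox.indicator fun s => torusDensity n (Fin.cons 0 s) with hg
  have hmain : Tendsto (fun n => ∫ s : Fin 3 → ℝ, (R n)⁻¹ ^ 12 * g n (R n • s)) atTop
      (nhds (∫ s : Fin 3 → ℝ, gaussDensity (Fin.cons 0 s))) := by
    refine tendsto_integral_filter_of_dominated_convergence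
      (fun s : Fin 3 → ℝ => 4 ^ 6 * (Real.exp (-(1 / (4 * Real.pi ^ 2)) * ∑ k, s k ^ 2) *
        (∏ k, (1 + s k ^ 2)) ^ 6)) ?_ ?_ ?_ ?_
    · refine Eventually.of_forall fun n => ?_
      have h1 : Measurable (g n) :=
        ((continuous_torusDensity n).comp hcons).measurable.indicator hbox
      exact ((h1.comp (measurable_const_smul (R n))).const_mul _).aestronglyMeasurable
    · filter_upwards [hRn] with n hn
      refine Eventually.of_forall fun s => ?_
      by_cases hs : R n • s ∈ angleBox
      · simp only [hg]
        rw [Set.indicator_of_mem hs, hsmul, Real.norm_eq_abs]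
        refine (abs_torusDensity_le hn hs).trans ?_
        rw [mul_left_comm]
        refine mul_le_mul_of_nonneg_left ?_ (Real.exp_nonneg _)
        refine (prod_sq_sub_le _).trans_eq ?_
        rw [Fin.prod_univ_succ]
        simp
      · simp only [hg]
        rw [Set.indicator_of_notMem hs]
        simp only [mul_zero, norm_zero]
        have : 0 ≤ ∏ k, (1 + s k ^ 2) := Finset.prod_nonneg fun k _ => by positivity
        positivity
    · exact (integrable_prod_gaussian (by positivity)).const_mul _
    · refine Eventually.of_forall fun s => ?_
      refine (tendsto_torusDensity hR0 hR hRn (Fin.cons 0 s)).congr' ?_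
      have hmem : ∀ᶠ n in atTop, R n • s ∈ angleBox := by
        have h1 : Tendsto (fun n => R n • s) atTop (nhds 0) := by
          simpa using hR.smul_const s
        refine h1.eventually_mem (set_pi_mem_nhds Set.finite_univ fun k _ => ?_)
        exact Ioc_mem_nhds (by simp [Real.pi_pos]) (by simp [Real.pi_pos])
      filter_upwards [hmem] with n hn
      simp only [hg]
      rw [Set.indicator_of_mem hn, hsmul]
  refine hmain.congr' ?_
  filter_upwards [eventually_gt_atTop 0] with n hn
  have hpos : (0 : ℝ) < √n := Real.sqrt_pos.2 (by exact_mod_cast hn)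
  rw [integral_const_mul, Measure.integral_comp_smul, hg, integral_indicator hbox,
    ← integral_torusDensity]
  simp only [hRdef, Module.finrank_fin_fun, inv_inv, smul_eq_mul, inv_pow,
    abs_of_pos (pow_pos hpos 3)]
  field_simp

/-- The moments of the Gaussian weight `exp (-x² / 4)`. -/
noncomputable def gaussMoment (k : ℕ) : ℝ := ∫ x : ℝ, x ^ k * Real.exp (-(1 / 4) * x ^ 2)

theorem gaussMoment_zero : gaussMoment 0 = 2 * √Real.pi := by
  simp only [gaussMoment, pow_zero, one_mul]
  rw [integral_gaussian, show Real.pi / (1 / 4) = 2 ^ 2 * Real.pi by ring,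
    Real.sqrt_mul (by norm_num), Real.sqrt_sq (by norm_num)]

theorem gaussMoment_succ (k : ℕ) : gaussMoment (k + 1) = 2 * k * gaussMoment (k - 1) := by
  have hi := integrable_pow_mul_gaussian (b := 1 / 4) (by norm_num)
  have hd : ∀ x : ℝ, HasDerivAt (fun x : ℝ => x ^ k * Real.exp (-(1 / 4) * x ^ 2))
      (k * (x ^ (k - 1) * Real.exp (-(1 / 4) * x ^ 2)) -
        1 / 2 * (x ^ (k + 1) * Real.exp (-(1 / 4) * x ^ 2))) x := by
    intro x
    have h := (hasDerivAt_pow k x).mul ((hasDerivAt_pow 2 x).const_mul (-(1 / 4) : ℝ)).exp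
    refine h.congr_deriv ?_
    push_cast
    ring
  have h := MeasureTheory.integral_eq_zero_of_hasDerivAt_of_integrable hd
    (((hi (k - 1)).const_mul _).sub ((hi (k + 1)).const_mul _)) (hi k)
  rw [MeasureTheory.integral_sub ((hi (k - 1)).const_mul _) ((hi (k + 1)).const_mul _),
    MeasureTheory.integral_const_mul, MeasureTheory.integral_const_mul] at h
  change k * gaussMoment (k - 1) - 1 / 2 * gaussMoment (k + 1) = 0 at h
  linarith

theorem det_gaussMoment :
    (Matrix.of fun i j : Fin 4 => gaussMoment (i + j)).det = 768 * 16 * Real.pi ^ 2 := by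
  have h1 : gaussMoment 1 = 0 := by simp [gaussMoment_succ 0]
  have h2 : gaussMoment 2 = 2 * gaussMoment 0 := by rw [gaussMoment_succ 1]; norm_num
  have h3 : gaussMoment 3 = 0 := by simp [gaussMoment_succ 2, h1]
  have h4 : gaussMoment 4 = 12 * gaussMoment 0 := by
    rw [gaussMoment_succ 3]
    norm_num [h2]
    ring
  have h5 : gaussMoment 5 = 0 := by simp [gaussMoment_succ 4, h3]
  have h6 : gaussMoment 6 = 120 * gaussMoment 0 := by
    rw [gaussMoment_succ 5]
    norm_num [h4]
    ring
  have hM : (Matrix.of fun i j : Fin 4 => gaussMoment (i + j)) =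
      gaussMoment 0 • !![1, 0, 2, 0; 0, 2, 0, 12; 2, 0, 12, 0; 0, 12, 0, 120] := by
    ext i j
    fin_cases i <;> fin_cases j <;> simp [h1, h2, h3, h4, h5, h6, mul_comm]
  have hdet : (!![1, 0, 2, 0; 0, 2, 0, 12; 2, 0, 12, 0; 0, 12, 0, 120] :
      Matrix (Fin 4) (Fin 4) ℝ).det = 768 := by
    simp [Matrix.det_succ_row_zero, Fin.sum_univ_succ, Fin.succAbove]
    norm_num
  have hpi : √Real.pi ^ 4 = Real.pi ^ 2 := by
    rw [show 4 = 2 * 2 from rfl, pow_mul, Real.sq_sqrt Real.pi_pos.le]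
  rw [hM, Matrix.det_smul, hdet, gaussMoment_zero, Fintype.card_fin, mul_pow, hpi]
  ring

/-- The density of the Gaussian unitary ensemble of size four, up to normalisation. -/
noncomputable def gueDensity (t : Fin 4 → ℝ) : ℝ :=
  Real.exp (-(1 / 4) * ∑ i, t i ^ 2) * ∏ i, ∏ j ∈ Finset.Ioi i, (t j - t i) ^ 2

theorem continuous_gueDensity : Continuous gueDensity := by
  unfold gueDensity
  fun_prop

open MeasureTheory in
theorem integrable_gueDensity : Integrable gueDensity := by
  refine ((integrable_prod_gaussian (m := 4) (b := 1 / 4) (by norm_num)).const_mul (4 ^ 6)).mono'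
    continuous_gueDensity.aestronglyMeasurable (Eventually.of_forall fun t => ?_)
  rw [gueDensity, Real.norm_of_nonneg (mul_nonneg (Real.exp_nonneg _)
    (Finset.prod_nonneg fun i _ => Finset.prod_nonneg fun j _ => sq_nonneg _)), mul_left_comm]
  exact mul_le_mul_of_nonneg_left (prod_sq_sub_le t) (Real.exp_nonneg _)

open MeasureTheory in
theorem integral_gueDensity : ∫ t, gueDensity t = 24 * (768 * 16 * Real.pi ^ 2) := by
  have hV : ∀ t : Fin 4 → ℝ, ∏ i, ∏ j ∈ Finset.Ioi i, (t j - t i) =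
      ∑ σ : Equiv.Perm (Fin 4), (Equiv.Perm.sign σ : ℝ) * ∏ k, t k ^ (σ k : ℕ) := by
    intro t
    rw [← Matrix.det_vandermonde, ← Matrix.det_transpose, Matrix.det_apply']
    simp [Matrix.vandermonde_apply]
  have hpt : ∀ t : Fin 4 → ℝ, gueDensity t = ∑ σ : Equiv.Perm (Fin 4), ∑ τ : Equiv.Perm (Fin 4),
      (Equiv.Perm.sign σ * Equiv.Perm.sign τ : ℝ) *
        ∏ k, (t k ^ (σ k + τ k : ℕ) * Real.exp (-(1 / 4) * t k ^ 2)) := by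
    intro t
    rw [gueDensity]
    simp only [Finset.prod_pow, hV]
    rw [sq, Finset.sum_mul_sum, Finset.mul_sum]
    refine Finset.sum_congr rfl fun σ _ => ?_
    rw [Finset.mul_sum]
    refine Finset.sum_congr rfl fun τ _ => ?_
    rw [Finset.prod_mul_distrib, ← Real.exp_sum, ← Finset.mul_sum]
    simp only [pow_add, Finset.prod_mul_distrib]
    ring
  have hi : ∀ σ τ : Equiv.Perm (Fin 4), Integrable fun t : Fin 4 → ℝ =>
      (Equiv.Perm.sign σ * Equiv.Perm.sign τ : ℝ) *
        ∏ k, (t k ^ (σ k + τ k : ℕ) * Real.exp (-(1 / 4) * t k ^ 2)) := fun σ τ =>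
    (Integrable.fintype_prod (μ := fun _ => volume)
      (f := fun (k : Fin 4) (x : ℝ) => x ^ (σ k + τ k : ℕ) * Real.exp (-(1 / 4) * x ^ 2))
      fun k => integrable_pow_mul_gaussian (by norm_num) _).const_mul _
  simp only [hpt]
  rw [integral_finsetSum _ fun σ _ => integrable_finsetSum _ fun τ _ => hi σ τ]
  have hσ : ∀ σ : Equiv.Perm (Fin 4), ∫ t : Fin 4 → ℝ, ∑ τ : Equiv.Perm (Fin 4),
      (Equiv.Perm.sign σ * Equiv.Perm.sign τ : ℝ) *
        ∏ k, (t k ^ (σ k + τ k : ℕ) * Real.exp (-(1 / 4) * t k ^ 2)) =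
      768 * 16 * Real.pi ^ 2 := by
    intro σ
    have hsign : (Equiv.Perm.sign σ : ℝ) * Equiv.Perm.sign σ = 1 := by
      rcases Int.units_eq_one_or (Equiv.Perm.sign σ) with h | h <;> simp [h]
    have hperm : 768 * 16 * Real.pi ^ 2 = (Equiv.Perm.sign σ : ℝ) *
        (Matrix.of fun i j : Fin 4 => gaussMoment (i + σ j)).det := by
      have h := Matrix.det_permute' σ (Matrix.of fun i j : Fin 4 => gaussMoment (i + j))
      change (Matrix.of fun i j : Fin 4 => gaussMoment (i + σ j)).det = _ at h
      rw [h, ← mul_assoc, hsign, one_mul, det_gaussMoment]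
    rw [integral_finsetSum _ fun τ _ => hi σ τ, hperm, Matrix.det_apply', Finset.mul_sum]
    refine Finset.sum_congr rfl fun τ _ => ?_
    rw [integral_const_mul, mul_assoc, integral_fintype_prod_volume_eq_prod
      (f := fun (k : Fin 4) (x : ℝ) => x ^ (σ k + τ k : ℕ) * Real.exp (-(1 / 4) * x ^ 2))]
    congr 2
    refine Finset.prod_congr rfl fun k _ => ?_
    simp [gaussMoment, add_comm]
  rw [Finset.sum_congr rfl fun σ _ => hσ σ, Finset.sum_const, Finset.card_univ, Fintype.card_perm,
    Fintype.card_fin]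
  simp [Nat.factorial]

theorem gueDensity_add (t : Fin 4 → ℝ) (u : ℝ) :
    gueDensity (fun i => t i + u) =
      Real.exp (-1 * (u + (∑ i, t i) / 4) ^ 2) * gaussDensity t := by
  rw [gueDensity, gaussDensity, ← mul_assoc, ← Real.exp_add]
  simp only [add_sub_add_right_eq_sub]
  congr 2
  simp only [Fin.sum_univ_four]
  ring

open MeasureTheory in
theorem measurePreserving_cons_add :
    MeasurePreserving (fun p : ℝ × (Fin 3 → ℝ) =>
      (fun i => (Fin.cons 0 p.2 : Fin 4 → ℝ) i + p.1)) := by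
  have h1 := (volume_preserving_piFinSuccAbove (fun _ : Fin 4 => ℝ) 0).symm
  have h2 : MeasurePreserving (fun p : ℝ × (Fin 3 → ℝ) => (p.1, p.2 + fun _ => p.1))
      (volume.prod volume) (volume.prod volume) := by
    refine (MeasurePreserving.id volume).skew_product (g := fun u s => s + fun _ => u) ?_ ?_
    · exact Continuous.measurable (by unfold Function.uncurry; fun_prop)
    · exact Eventually.of_forall fun u => (measurePreserving_add_right volume _).map_eq
  rw [Measure.volume_eq_prod]
  convert h1.comp h2 using 1
  ext p i
  refine Fin.cases ?_ (fun k => ?_) i <;> simp [MeasurableEquiv.piFinSuccAbove]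

open MeasureTheory in
theorem integral_gaussDensity :
    √Real.pi * ∫ s : Fin 3 → ℝ, gaussDensity (Fin.cons 0 s) = 24 * (768 * 16 * Real.pi ^ 2) := by
  have hmp := measurePreserving_cons_add
  have hint := hmp.integrable_comp_of_integrable integrable_gueDensity
  have h1 := integral_map hmp.measurable.aemeasurable
    (continuous_gueDensity.aestronglyMeasurable (μ := Measure.map _ volume))
  rw [hmp.map_eq, integral_gueDensity] at h1
  rw [Measure.volume_eq_prod] at h1 hint
  rw [Function.comp_def] at hint
  rw [h1, integral_prod_symm _ hint, ← integral_const_mul]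
  refine integral_congr_ae (Eventually.of_forall fun s => ?_)
  simp only [gueDensity_add]
  rw [integral_mul_const, integral_add_right_eq_self fun u : ℝ => Real.exp (-1 * u ^ 2),
    integral_gaussian, div_one]

/-- Regev: `s_n(12345) ~ (3⬝2⁹/π^(3/2)) ⬝ 16ⁿ ⬝ n^(-15/2)` as `n → ∞`. -/
theorem stmt_11 :
    Tendsto (fun n : ℕ =>
        (avoidCount patt12345 n : ℝ) * (Real.pi ^ ((3 : ℝ) / 2) * (n : ℝ) ^ ((15 : ℝ) / 2)) /
          (3 * 2 ^ 9 * 16 ^ n))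
      atTop (nhds 1) := by
  have hrpow : ∀ (x : ℝ) (k : ℕ), 0 ≤ x → x ^ ((k : ℝ) / 2) = √x ^ k := by
    intro x k hx
    rw [Real.sqrt_eq_rpow, ← Real.rpow_mul_natCast hx]
    congr 1
    ring
  have hpi : Real.pi = √Real.pi ^ 2 := (Real.sq_sqrt Real.pi_pos.le).symm
  have hpos : 0 < √Real.pi := Real.sqrt_pos.2 Real.pi_pos
  have hJ := integral_gaussDensity
  have h := tendsto_avoidCount.const_mul (√Real.pi ^ 3 / ((2 * Real.pi) ^ 3 * 24 * (3 * 2 ^ 9)))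
  have hlim : √Real.pi ^ 3 / ((2 * Real.pi) ^ 3 * 24 * (3 * 2 ^ 9)) *
      ∫ s : Fin 3 → ℝ, gaussDensity (Fin.cons 0 s) = 1 := by
    generalize (∫ s : Fin 3 → ℝ, gaussDensity (Fin.cons 0 s)) = J at hJ
    rw [← mul_right_inj' hpos.ne', mul_left_comm, hJ]
    generalize √Real.pi = r at *
    rw [hpi]
    field_simp
    norm_num
  rw [hlim] at h
  refine h.congr fun n => ?_
  have h3 := hrpow Real.pi 3 Real.pi_pos.le
  have h15 := hrpow n 15 n.cast_nonneg
  push_cast at h3 h15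
  rw [h3, h15]
  have := Real.pi_pos
  field_simp
end
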